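/- arXiv:1309.6604 — 2 statements merged into one kernel-verified Lean document; each statement's English description precedes it below -/
import Mathlib

section
/- (Continuity of the planar Young integrals under Hölder convergence.) Let γ_1, γ_2 > 1/2, let φ ∈ C^4(ℝ,ℝ) be bounded with bounded derivatives up to order four, and let x, x^n : [0,1]^2 → ℝ (n ≥ 1) be continuous with sup_n N_{γ_1,γ_2}(x^n) < ∞ and lim_{n→∞} N_{γ_1,γ_2}(x^n - x) = 0. For each rectangle, let z^{1,n}, z^{2,n} (resp. z^1, z^2) be the limits of the Riemann sums Σ φ'(x^n(σ_i,τ_j)) δx^n_{σ_i σ_{i+1};τ_j τ_{j+1}} and Σ φ''(x^n(σ_i,τ_j)) δ_1 x^n_{σ_i σ_{i+1};τ_j} δ_2 x^n_{σ_i;τ_j τ_{j+1}} (resp. the same sums for x) as the mesh tends to 0. Then for j = 1,2, sup over all rectangles [s_1,s_2] × [t_1,t_2] ⊆ [0,1]^2 of |z^{j,n}_{s_1 s_2;t_1 t_2} - z^j_{s_1 s_2;t_1 t_2}| tends to 0 as n → ∞. -/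
open Set Filter
open scoped ENNReal Topology

noncomputable section

def I01 : Set ℝ := Set.Icc 0 1

/-- Rectangular increment of a two-parameter function. -/
def dRect (f : ℝ → ℝ → ℝ) (s1 s2 t1 t2 : ℝ) : ℝ :=
  f s2 t2 - f s1 t2 - f s2 t1 + f s1 t1

/-- Increment in the first direction. -/
def d1 (f : ℝ → ℝ → ℝ) (s1 s2 t : ℝ) : ℝ := f s2 t - f s1 t

/-- Increment in the second direction. -/
def d2 (f : ℝ → ℝ → ℝ) (s t1 t2 : ℝ) : ℝ := f s t2 - f s t1

/-- Two-parameter Hölder seminorm of the rectangular increments. -/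
noncomputable def holRect (a1 a2 : ℝ) (f : ℝ → ℝ → ℝ) : ℝ≥0∞ :=
  ⨆ (s1 : I01) (s2 : I01) (t1 : I01) (t2 : I01),
    ENNReal.ofReal (|dRect f (s1 : ℝ) (s2 : ℝ) (t1 : ℝ) (t2 : ℝ)| /
      (|(s2 : ℝ) - (s1 : ℝ)| ^ a1 * |(t2 : ℝ) - (t1 : ℝ)| ^ a2))

/-- Hölder seminorm in the first direction. -/
noncomputable def hol1 (a1 : ℝ) (f : ℝ → ℝ → ℝ) : ℝ≥0∞ :=
  ⨆ (s1 : I01) (s2 : I01) (t : I01),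
    ENNReal.ofReal (|d1 f (s1 : ℝ) (s2 : ℝ) (t : ℝ)| / |(s2 : ℝ) - (s1 : ℝ)| ^ a1)

/-- Hölder seminorm in the second direction. -/
noncomputable def hol2 (a2 : ℝ) (f : ℝ → ℝ → ℝ) : ℝ≥0∞ :=
  ⨆ (s : I01) (t1 : I01) (t2 : I01),
    ENNReal.ofReal (|d2 f (s : ℝ) (t1 : ℝ) (t2 : ℝ)| / |(t2 : ℝ) - (t1 : ℝ)| ^ a2)

/-- Supremum norm on the unit square. -/
noncomputable def holInf (f : ℝ → ℝ → ℝ) : ℝ≥0∞ :=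
  ⨆ (s : I01) (t : I01), ENNReal.ofReal |f (s : ℝ) (t : ℝ)|

/-- The norm `N_{a1,a2}`. -/
noncomputable def NN (a1 a2 : ℝ) (f : ℝ → ℝ → ℝ) : ℝ≥0∞ :=
  holRect a1 a2 f + hol1 a1 f + hol2 a2 f + holInf f

/-- A sequence of partitions of `[a,b]` whose mesh tends to `0`. -/
def IsPartSeq (a b : ℝ) (m : ℕ → ℕ) (σ : ℕ → ℕ → ℝ) : Prop :=
  (∀ n, σ n 0 = a) ∧ (∀ n, σ n (m n) = b) ∧
  (∀ n, ∀ i < m n, σ n i < σ n (i + 1)) ∧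
  ∀ ε : ℝ, 0 < ε → ∃ N : ℕ, ∀ n ≥ N, ∀ i < m n, σ n (i + 1) - σ n i < ε

/-- Dyadic points. -/
def dyp (a b : ℝ) (k i : ℕ) : ℝ := a + (b - a) * ((i : ℝ) / 2 ^ k)

/-- Dyadic sums. -/
def DS (F : ℝ → ℝ → ℝ) (a b : ℝ) (k : ℕ) : ℝ :=
  ∑ i ∈ Finset.range (2 ^ k), F (dyp a b k i) (dyp a b k (i + 1))

lemma dyp_mem {a b : ℝ} (ha : a ∈ I01) (hb : b ∈ I01) (hab : a ≤ b) {k i : ℕ} (hi : i ≤ 2 ^ k) :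
    dyp a b k i ∈ I01 := by
  unfold I01 at *
  have h2 : (0 : ℝ) < 2 ^ k := by positivity
  have h0 : (0 : ℝ) ≤ (i : ℝ) / 2 ^ k := by positivity
  have h1 : (i : ℝ) / 2 ^ k ≤ 1 := by
    rw [div_le_one h2]
    exact_mod_cast hi
  unfold dyp
  constructor
  · have := ha.1
    have := mul_nonneg (sub_nonneg.2 hab) h0
    linarith
  · have := hb.2
    have := mul_le_mul_of_nonneg_left h1 (sub_nonneg.2 hab)
    linarith

lemma dyp_le {a b : ℝ} (hab : a ≤ b) (k i : ℕ) : dyp a b k i ≤ dyp a b k (i + 1) := by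
  unfold dyp
  have := sub_nonneg.2 hab
  gcongr
  simp

lemma dyp_step (a b : ℝ) (k i : ℕ) : dyp a b k (i + 1) - dyp a b k i = (b - a) / 2 ^ k := by
  unfold dyp
  push_cast
  ring

lemma dyp_double (a b : ℝ) (k i : ℕ) : dyp a b (k + 1) (2 * i) = dyp a b k i := by
  unfold dyp
  push_cast
  rw [pow_succ]
  field_simp

lemma sum_range_double (f : ℕ → ℝ) (n : ℕ) :
    ∑ i ∈ Finset.range (2 * n), f i = ∑ i ∈ Finset.range n, (f (2 * i) + f (2 * i + 1)) := by
  induction n with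
  | zero => simp
  | succ n ih =>
    rw [Finset.sum_range_succ, ← ih, show 2 * (n + 1) = 2 * n + 1 + 1 by ring,
      Finset.sum_range_succ, Finset.sum_range_succ]
    ring

/-- ratio -/
def qq (γ : ℝ) : ℝ := (2 : ℝ) ^ (1 - 2 * γ)

lemma qq_pos (γ : ℝ) : 0 < qq γ := by unfold qq; positivity

lemma qq_lt_one {γ : ℝ} (h : 1 / 2 < γ) : qq γ < 1 := by
  unfold qq
  apply Real.rpow_lt_one_of_one_lt_of_neg <;> linarith

lemma DS_step {F : ℝ → ℝ → ℝ} {a b γ D : ℝ} (ha : a ∈ I01) (hb : b ∈ I01) (hab : a ≤ b)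
    (hγ : 1 / 2 < γ) (hD : 0 ≤ D)
    (hF : ∀ s ∈ I01, ∀ m ∈ I01, ∀ s' ∈ I01, s ≤ m → m ≤ s' →
      |F s m + F m s' - F s s'| ≤ D * (s' - s) ^ (2 * γ)) (k : ℕ) :
    |DS F a b (k + 1) - DS F a b k| ≤ D * qq γ ^ k := by
  unfold DS
  rw [pow_succ, mul_comm (2 ^ k) 2, sum_range_double, ← Finset.sum_sub_distrib]
  have hterm : ∀ i ∈ Finset.range (2 ^ k),
      |F (dyp a b (k + 1) (2 * i)) (dyp a b (k + 1) (2 * i + 1)) +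
        F (dyp a b (k + 1) (2 * i + 1)) (dyp a b (k + 1) (2 * i + 1 + 1)) -
        F (dyp a b k i) (dyp a b k (i + 1))| ≤ D * ((2 : ℝ) ^ k) ^ (- (2 * γ)) := by
    intro i hi
    have hi := Finset.mem_range.1 hi
    have hb1 : 2 * i + 1 + 1 ≤ 2 ^ (k + 1) := by rw [pow_succ]; omega
    have e1 := dyp_double a b k i
    have e2 : dyp a b (k + 1) (2 * i + 1 + 1) = dyp a b k (i + 1) := dyp_double a b k (i + 1)
    rw [← e1, ← e2]
    refine (hF _ (dyp_mem ha hb hab (by omega)) _ (dyp_mem ha hb hab (by omega)) _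
      (dyp_mem ha hb hab hb1) (dyp_le hab _ _) (dyp_le hab _ _)).trans ?_
    rw [e1, e2, dyp_step, Real.rpow_neg (by positivity), ← Real.inv_rpow (by positivity)]
    unfold I01 at ha hb
    have h0 : 0 ≤ b - a := by linarith
    have h1 : (b - a) / 2 ^ k ≤ ((2 : ℝ) ^ k)⁻¹ := by
      rw [div_eq_mul_inv]
      have : 0 < ((2 : ℝ) ^ k)⁻¹ := by positivity
      have : b - a ≤ 1 := by linarith [ha.1, hb.2]
      nlinarith
    gcongr
  refine (Finset.abs_sum_le_sum_abs _ _).trans ((Finset.sum_le_sum hterm).trans ?_)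
  rw [Finset.sum_const, Finset.card_range, nsmul_eq_mul]
  apply le_of_eq
  unfold qq
  push_cast
  rw [← Real.rpow_natCast ((2 : ℝ) ^ (1 - 2 * γ)), ← Real.rpow_natCast 2, ← Real.rpow_mul (by norm_num),
    ← Real.rpow_mul (by norm_num), mul_left_comm, ← Real.rpow_add (by norm_num)]
  congr 2
  ring

lemma DS_zero (F : ℝ → ℝ → ℝ) (a b : ℝ) : DS F a b 0 = F a b := by
  simp [DS, dyp]

lemma DS_bound {F : ℝ → ℝ → ℝ} {a b γ D : ℝ} (ha : a ∈ I01) (hb : b ∈ I01) (hab : a ≤ b)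
    (hγ : 1 / 2 < γ) (hD : 0 ≤ D)
    (hF : ∀ s ∈ I01, ∀ m ∈ I01, ∀ s' ∈ I01, s ≤ m → m ≤ s' →
      |F s m + F m s' - F s s'| ≤ D * (s' - s) ^ (2 * γ)) (k : ℕ) :
    |DS F a b k| ≤ |F a b| + D / (1 - qq γ) := by
  have hq1 := qq_lt_one hγ
  have hq0 := qq_pos γ
  have key : |DS F a b k| ≤ |F a b| + D / (1 - qq γ) * (1 - qq γ ^ k) := by
    induction k with
    | zero => simp [DS_zero]
    | succ k ih =>
      have h := DS_step ha hb hab hγ hD hF k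
      have h2 : |DS F a b (k + 1)| ≤ |DS F a b k| + |DS F a b (k + 1) - DS F a b k| := by
        have := abs_add_le (DS F a b k) (DS F a b (k + 1) - DS F a b k)
        simpa using this
      have e : D / (1 - qq γ) * (1 - qq γ ^ (k + 1)) =
          D / (1 - qq γ) * (1 - qq γ ^ k) + D * qq γ ^ k := by
        have : 1 - qq γ ≠ 0 := by linarith
        field_simp
        ring
      rw [e]
      linarith
  have h3 : 0 ≤ D / (1 - qq γ) := div_nonneg hD (by linarith)
  have h4 : 0 ≤ qq γ ^ k := by positivity
  nlinarith

/-- constant -/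
def KK (γ : ℝ) : ℝ := 1 + 1 / (1 - qq γ)

lemma KK_pos {γ : ℝ} (h : 1 / 2 < γ) : 0 < KK γ := by
  have := qq_lt_one h
  have : 0 < 1 / (1 - qq γ) := by apply one_div_pos.2; linarith
  unfold KK; linarith

lemma rpow_le_one' {s s' γ : ℝ} (hs : s ∈ I01) (hs' : s' ∈ I01) (hγ : 1 / 2 < γ) :
    |s' - s| ^ γ ≤ 1 := by
  unfold I01 at *
  apply Real.rpow_le_one (abs_nonneg _) _ (by linarith)
  rw [abs_le]
  constructor <;> linarith [hs.1, hs.2, hs'.1, hs'.2]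

lemma young1 {Y X : ℝ → ℝ} {a b γ M A : ℝ} (ha : a ∈ I01) (hb : b ∈ I01) (hab : a ≤ b)
    (hγ : 1 / 2 < γ) (hM : 0 ≤ M) (hA : 0 ≤ A)
    (hY0 : ∀ t ∈ I01, |Y t| ≤ M)
    (hY : ∀ t ∈ I01, ∀ t' ∈ I01, |Y t' - Y t| ≤ M * |t' - t| ^ γ)
    (hX : ∀ t ∈ I01, ∀ t' ∈ I01, |X t' - X t| ≤ A * |t' - t| ^ γ) (k : ℕ) :
    |DS (fun t t' => Y t * (X t' - X t)) a b k| ≤ M * A * KK γ := by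
  have h := DS_bound (F := fun t t' => Y t * (X t' - X t)) (D := M * A) ha hb hab hγ
    (by positivity) ?_ k
  · refine h.trans ?_
    have h1 : |Y a * (X b - X a)| ≤ M * A := by
      rw [abs_mul]
      have := hX a ha b hb
      have h2 := rpow_le_one' ha hb hγ
      have h3 : |X b - X a| ≤ A := this.trans (by nlinarith)
      have := hY0 a ha
      gcongr
    have h4 : M * A * KK γ = M * A + M * A / (1 - qq γ) := by unfold KK; ring
    linarith
  · intro s hs m hm s' hs' h1 h2
    have e : Y s * (X m - X s) + Y m * (X s' - X m) - Y s * (X s' - X s) =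
      (Y m - Y s) * (X s' - X m) := by ring
    simp only [e, abs_mul]
    have b1 := hY s hs m hm
    have b2 := hX m hm s' hs'
    rw [abs_of_nonneg (a := m - s) (by linarith)] at b1
    rw [abs_of_nonneg (a := s' - m) (by linarith)] at b2
    have c1 : (m - s) ^ γ ≤ (s' - s) ^ γ :=
      Real.rpow_le_rpow (by linarith) (by linarith) (by linarith)
    have c2 : (s' - m) ^ γ ≤ (s' - s) ^ γ :=
      Real.rpow_le_rpow (by linarith) (by linarith) (by linarith)
    have e2 : (s' - s) ^ (2 * γ) = (s' - s) ^ γ * (s' - s) ^ γ := by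
      rw [two_mul, Real.rpow_add_of_nonneg (by linarith) (by linarith) (by linarith)]
    rw [e2]
    calc |Y m - Y s| * |X s' - X m| ≤ (M * (s' - s) ^ γ) * (A * (s' - s) ^ γ) := by
          have r0 : 0 ≤ (s' - s) ^ γ := Real.rpow_nonneg (by linarith) _
          exact mul_le_mul (b1.trans (by gcongr)) (b2.trans (by gcongr)) (abs_nonneg _)
            (by positivity)
      _ = _ := by ring

/-- Hölder bound, in elementary form. -/
structure Hol (γ1 γ2 B : ℝ) (f : ℝ → ℝ → ℝ) : Prop where
  h1 : ∀ s ∈ I01, ∀ s' ∈ I01, ∀ t ∈ I01, |f s' t - f s t| ≤ B * |s' - s| ^ γ1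
  h2 : ∀ s ∈ I01, ∀ t ∈ I01, ∀ t' ∈ I01, |f s t' - f s t| ≤ B * |t' - t| ^ γ2
  hr : ∀ s ∈ I01, ∀ s' ∈ I01, ∀ t ∈ I01, ∀ t' ∈ I01,
    |dRect f s s' t t'| ≤ B * (|s' - s| ^ γ1 * |t' - t| ^ γ2)

lemma Hol.swap {γ1 γ2 B : ℝ} {f : ℝ → ℝ → ℝ} (h : Hol γ1 γ2 B f) :
    Hol γ2 γ1 B (fun t s => f s t) where
  h1 := fun s hs s' hs' t ht => h.h2 t ht s hs s' hs'
  h2 := fun s hs s' hs' t ht => h.h1 s' hs' t ht s hs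
  hr := fun s hs s' hs' t ht t' ht' => by
    have := h.hr t ht t' ht' s hs s' hs'
    unfold dRect at *
    rw [mul_comm (|s' - s| ^ γ2)]
    convert this using 2
    ring

lemma Hol.mono {γ1 γ2 B B' : ℝ} {f : ℝ → ℝ → ℝ} (h : Hol γ1 γ2 B f) (hB : B ≤ B') :
    Hol γ1 γ2 B' f where
  h1 := fun s hs s' hs' t ht => (h.h1 s hs s' hs' t ht).trans (by gcongr)
  h2 := fun s hs s' hs' t ht => (h.h2 s hs s' hs' t ht).trans (by gcongr)
  hr := fun s hs s' hs' t ht t' ht' => (h.hr s hs s' hs' t ht t' ht').trans (by gcongr)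

/-- sums of first type -/
def S1 (G x : ℝ → ℝ → ℝ) (a b c d : ℝ) (k l : ℕ) : ℝ :=
  DS (fun s s' => DS (fun t t' => G s t * dRect x s s' t t') c d l) a b k

/-- sums of second type -/
def S2 (G x : ℝ → ℝ → ℝ) (a b c d : ℝ) (k l : ℕ) : ℝ :=
  DS (fun s s' => DS (fun t t' => G s t * d1 x s s' t * d2 x s t t') c d l) a b k

lemma S1_swap (G x : ℝ → ℝ → ℝ) (a b c d : ℝ) (k l : ℕ) :
    S1 (fun t s => G s t) (fun t s => x s t) c d a b l k = S1 G x a b c d k l := by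
  unfold S1 DS
  rw [Finset.sum_comm]
  refine Finset.sum_congr rfl fun i _ => Finset.sum_congr rfl fun j _ => ?_
  unfold dRect
  ring

lemma S2_swap (G x : ℝ → ℝ → ℝ) (a b c d : ℝ) (k l : ℕ) :
    S2 (fun t s => G s t) (fun t s => x s t) c d a b l k = S2 G x a b c d k l := by
  unfold S2 DS
  rw [Finset.sum_comm]
  refine Finset.sum_congr rfl fun i _ => Finset.sum_congr rfl fun j _ => ?_
  unfold d1 d2
  ring

lemma DS_add (F H : ℝ → ℝ → ℝ) (a b : ℝ) (k : ℕ) :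
    DS F a b k + DS H a b k = DS (fun s s' => F s s' + H s s') a b k := by
  unfold DS; rw [Finset.sum_add_distrib]

lemma DS_sub (F H : ℝ → ℝ → ℝ) (a b : ℝ) (k : ℕ) :
    DS F a b k - DS H a b k = DS (fun s s' => F s s' - H s s') a b k := by
  unfold DS; rw [Finset.sum_sub_distrib]

lemma Hol.le1 {γ1 γ2 B : ℝ} {f : ℝ → ℝ → ℝ} (h : Hol γ1 γ2 B f) (hB : 0 ≤ B) (hγ : 1 / 2 < γ1)
    {s m m' s' t : ℝ} (h1 : s ≤ m) (h2 : m ≤ m') (h3 : m' ≤ s')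
    (hm : m ∈ I01) (hm' : m' ∈ I01) (ht : t ∈ I01) :
    |f m' t - f m t| ≤ B * (s' - s) ^ γ1 := by
  refine (h.h1 m hm m' hm' t ht).trans ?_
  rw [abs_of_nonneg (by linarith)]
  gcongr

lemma Hol.ler {γ1 γ2 B : ℝ} {f : ℝ → ℝ → ℝ} (h : Hol γ1 γ2 B f) (hB : 0 ≤ B) (hγ : 1 / 2 < γ1)
    {s m m' s' t t' : ℝ} (h1 : s ≤ m) (h2 : m ≤ m') (h3 : m' ≤ s')
    (hm : m ∈ I01) (hm' : m' ∈ I01) (ht : t ∈ I01) (ht' : t' ∈ I01) :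
    |(f m' t' - f m t') - (f m' t - f m t)| ≤ B * (s' - s) ^ γ1 * |t' - t| ^ γ2 := by
  have := h.hr m hm m' hm' t ht t' ht'
  unfold dRect at this
  rw [abs_of_nonneg (a := m' - m) (by linarith)] at this
  rw [show (f m' t' - f m t') - (f m' t - f m t) = f m' t' - f m t' - f m' t + f m t by ring]
  refine this.trans ?_
  rw [mul_assoc]
  gcongr

lemma S1_step {γ1 γ2 B a b c d : ℝ} {G x : ℝ → ℝ → ℝ} (hγ1 : 1 / 2 < γ1) (hγ2 : 1 / 2 < γ2)
    (hB : 0 ≤ B) (hG : Hol γ1 γ2 B G) (hx : Hol γ1 γ2 B x)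
    (ha : a ∈ I01) (hb : b ∈ I01) (hc : c ∈ I01) (hd : d ∈ I01) (hab : a ≤ b) (hcd : c ≤ d)
    (k l : ℕ) :
    |S1 G x a b c d (k + 1) l - S1 G x a b c d k l| ≤ B ^ 2 * KK γ2 * qq γ1 ^ k := by
  have hK := KK_pos hγ2
  unfold S1
  refine DS_step ha hb hab hγ1 (by positivity) ?_ k
  intro s hs m hm s' hs' h1 h2
  rw [DS_add, DS_sub]
  have e2 : (s' - s) ^ (2 * γ1) = (s' - s) ^ γ1 * (s' - s) ^ γ1 := by
    rw [two_mul, Real.rpow_add_of_nonneg (by linarith) (by linarith) (by linarith)]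
  have h0 : 0 ≤ (s' - s) ^ γ1 := Real.rpow_nonneg (by linarith) _
  have e : (fun t t' => G s t * dRect x s m t t' + G m t * dRect x m s' t t' -
      G s t * dRect x s s' t t') = fun t t' => (fun t => G m t - G s t) t *
        ((fun t => x s' t - x m t) t' - (fun t => x s' t - x m t) t) := by
    funext t t'
    simp only [dRect]
    ring
  rw [e]
  refine (young1 (Y := fun t => G m t - G s t) (X := fun t => x s' t - x m t) (γ := γ2)
    (M := B * (s' - s) ^ γ1) (A := B * (s' - s) ^ γ1) hc hd hcd hγ2 (by positivity) (by positivity)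
    ?_ ?_ ?_ l).trans (le_of_eq ?_)
  · intro t ht
    exact hG.le1 hB hγ1 le_rfl h1 h2 hs hm ht
  · intro t ht t' ht'
    exact hG.ler hB hγ1 le_rfl h1 h2 hs hm ht ht'
  · intro t ht t' ht'
    exact hx.ler hB hγ1 h1 h2 le_rfl hm hs' ht ht'
  · rw [e2]; ring

lemma mul_inc {y1 y1' y2 y2' M1 M2 r : ℝ} (hM1 : 0 ≤ M1)
    (a2 : |y1'| ≤ M1) (a3 : |y2| ≤ M2)
    (b1 : |y1' - y1| ≤ M1 * r) (b2 : |y2' - y2| ≤ M2 * r) :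
    |y1' * y2' - y1 * y2| ≤ 2 * (M1 * M2) * r := by
  have e : y1' * y2' - y1 * y2 = y1' * (y2' - y2) + (y1' - y1) * y2 := by ring
  rw [e]
  refine (abs_add_le _ _).trans ?_
  rw [abs_mul, abs_mul]
  have c1 : |y1'| * |y2' - y2| ≤ M1 * (M2 * r) := by gcongr
  have c2 : |y1' - y1| * |y2| ≤ (M1 * r) * M2 :=
    mul_le_mul b1 a3 (abs_nonneg _) ((abs_nonneg _).trans b1)
  linarith

lemma S2_step {γ1 γ2 B a b c d : ℝ} {G x : ℝ → ℝ → ℝ} (hγ1 : 1 / 2 < γ1) (hγ2 : 1 / 2 < γ2)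
    (hB : 0 ≤ B) (hG : Hol γ1 γ2 B G) (hx : Hol γ1 γ2 B x)
    (hG0 : ∀ s ∈ I01, ∀ t ∈ I01, |G s t| ≤ B)
    (ha : a ∈ I01) (hb : b ∈ I01) (hc : c ∈ I01) (hd : d ∈ I01) (hab : a ≤ b) (hcd : c ≤ d)
    (k l : ℕ) :
    |S2 G x a b c d (k + 1) l - S2 G x a b c d k l| ≤ 4 * B ^ 3 * KK γ2 * qq γ1 ^ k := by
  have hK := KK_pos hγ2
  unfold S2
  refine DS_step ha hb hab hγ1 (by positivity) ?_ k
  intro s hs m hm s' hs' h1 h2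
  rw [DS_add, DS_sub]
  have e2 : (s' - s) ^ (2 * γ1) = (s' - s) ^ γ1 * (s' - s) ^ γ1 := by
    rw [two_mul, Real.rpow_add_of_nonneg (by linarith) (by linarith) (by linarith)]
  have h0 : 0 ≤ (s' - s) ^ γ1 := Real.rpow_nonneg (by linarith) _
  have e : (fun t t' => G s t * d1 x s m t * d2 x s t t' + G m t * d1 x m s' t * d2 x m t t' -
      G s t * d1 x s s' t * d2 x s t t') = fun t t' =>
        (fun t => (x s' t - x m t) * (G m t - G s t)) t * (x m t' - x m t) +
        (fun t => (x s' t - x m t) * G s t) t *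
        ((fun t => x m t - x s t) t' - (fun t => x m t - x s t) t) := by
    funext t t'
    simp only [d1, d2]
    ring
  rw [e, ← DS_add]
  have A1 := young1 (Y := fun t => (x s' t - x m t) * (G m t - G s t)) (X := fun t => x m t)
    (γ := γ2) (M := 2 * ((B * (s' - s) ^ γ1) * (B * (s' - s) ^ γ1))) (A := B) hc hd hcd hγ2
    (by positivity) hB ?_ ?_ (fun t ht t' ht' => hx.h2 m hm t ht t' ht') l
  · have A2 := young1 (Y := fun t => (x s' t - x m t) * G s t) (X := fun t => x m t - x s t)
      (γ := γ2) (M := 2 * ((B * (s' - s) ^ γ1) * B)) (A := B * (s' - s) ^ γ1) hc hd hcd hγ2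
      (by positivity) (by positivity) ?_ ?_ ?_ l
    · refine (abs_add_le _ _).trans ((add_le_add A1 A2).trans (le_of_eq ?_))
      rw [e2]; ring
    · intro t ht
      rw [abs_mul]
      have u := hx.le1 hB hγ1 h1 h2 le_rfl hm hs' ht
      have v := hG0 s hs t ht
      have : 0 ≤ (B * (s' - s) ^ γ1) * B := by positivity
      have : |x s' t - x m t| * |G s t| ≤ (B * (s' - s) ^ γ1) * B := by gcongr
      linarith
    · intro t ht t' ht'
      exact mul_inc (by positivity) (hx.le1 hB hγ1 h1 h2 le_rfl hm hs' ht') (hG0 s hs t ht)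
        (hx.ler hB hγ1 h1 h2 le_rfl hm hs' ht ht') (hG.h2 s hs t ht t' ht')
    · intro t ht t' ht'
      exact hx.ler hB hγ1 le_rfl h1 h2 hs hm ht ht'
  · intro t ht
    rw [abs_mul]
    have u := hx.le1 hB hγ1 h1 h2 le_rfl hm hs' ht
    have v := hG.le1 hB hγ1 le_rfl h1 h2 hs hm ht
    have : 0 ≤ (B * (s' - s) ^ γ1) * (B * (s' - s) ^ γ1) := by positivity
    have : |x s' t - x m t| * |G m t - G s t| ≤ (B * (s' - s) ^ γ1) * (B * (s' - s) ^ γ1) := by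
      gcongr
    linarith
  · intro t ht t' ht'
    exact mul_inc (by positivity) (hx.le1 hB hγ1 h1 h2 le_rfl hm hs' ht')
      (hG.le1 hB hγ1 le_rfl h1 h2 hs hm ht)
      (hx.ler hB hγ1 h1 h2 le_rfl hm hs' ht ht') (hG.ler hB hγ1 le_rfl h1 h2 hs hm ht ht')

/-- final ratio -/
def QQ (γ1 γ2 : ℝ) : ℝ := max (qq γ1) (qq γ2)
/-- final constants -/
def CC (γ1 γ2 B : ℝ) : ℝ := (B ^ 2 + 4 * B ^ 3) * (KK γ1 + KK γ2)

lemma comb_aux {γ1 γ2 D K1 K2 A1 A2 E : ℝ} {k : ℕ} (hD : 0 ≤ D) (hK1 : 0 ≤ K1) (hK2 : 0 ≤ K2)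
    (hE : D ≤ E) 
    (h1 : |A1| ≤ D * K2 * qq γ1 ^ k) (h2 : |A2| ≤ D * K1 * qq γ2 ^ k) :
    |A1 + A2| ≤ E * (K1 + K2) * QQ γ1 γ2 ^ k := by
  have p1 := (qq_pos γ1).le
  have p2 := (qq_pos γ2).le
  have q1 : qq γ1 ^ k ≤ QQ γ1 γ2 ^ k := by gcongr; exact le_max_left _ _
  have q2 : qq γ2 ^ k ≤ QQ γ1 γ2 ^ k := by gcongr; exact le_max_right _ _
  have q0 : 0 ≤ QQ γ1 γ2 ^ k := (pow_nonneg p1 k).trans q1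
  calc |A1 + A2| ≤ |A1| + |A2| := abs_add_le _ _
    _ ≤ D * K2 * QQ γ1 γ2 ^ k + D * K1 * QQ γ1 γ2 ^ k := by
        refine add_le_add (h1.trans ?_) (h2.trans ?_) <;> gcongr
    _ = D * (K1 + K2) * QQ γ1 γ2 ^ k := by ring
    _ ≤ _ := by gcongr

lemma S1_diag {γ1 γ2 B a b c d : ℝ} {G x : ℝ → ℝ → ℝ} (hγ1 : 1 / 2 < γ1) (hγ2 : 1 / 2 < γ2)
    (hB : 0 ≤ B) (hG : Hol γ1 γ2 B G) (hx : Hol γ1 γ2 B x)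
    (ha : a ∈ I01) (hb : b ∈ I01) (hc : c ∈ I01) (hd : d ∈ I01) (hab : a ≤ b) (hcd : c ≤ d)
    (k : ℕ) :
    dist (S1 G x a b c d k k) (S1 G x a b c d (k + 1) (k + 1)) ≤
      CC γ1 γ2 B * QQ γ1 γ2 ^ k := by
  rw [dist_comm, Real.dist_eq]
  have h1 := S1_step hγ1 hγ2 hB hG hx ha hb hc hd hab hcd k (k + 1)
  have h2 := S1_step hγ2 hγ1 hB hG.swap hx.swap hc hd ha hb hcd hab k k
  rw [S1_swap G x a b c d k (k + 1), S1_swap G x a b c d k k] at h2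
  have := comb_aux (E := B ^ 2 + 4 * B ^ 3) (by positivity) (KK_pos hγ1).le (KK_pos hγ2).le
    (by have : 0 ≤ B ^ 3 := by positivity
        linarith) h1 h2
  simpa [CC] using this

lemma S2_diag {γ1 γ2 B a b c d : ℝ} {G x : ℝ → ℝ → ℝ} (hγ1 : 1 / 2 < γ1) (hγ2 : 1 / 2 < γ2)
    (hB : 0 ≤ B) (hG : Hol γ1 γ2 B G) (hx : Hol γ1 γ2 B x)
    (hG0 : ∀ s ∈ I01, ∀ t ∈ I01, |G s t| ≤ B)
    (ha : a ∈ I01) (hb : b ∈ I01) (hc : c ∈ I01) (hd : d ∈ I01) (hab : a ≤ b) (hcd : c ≤ d)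
    (k : ℕ) :
    dist (S2 G x a b c d k k) (S2 G x a b c d (k + 1) (k + 1)) ≤
      CC γ1 γ2 B * QQ γ1 γ2 ^ k := by
  rw [dist_comm, Real.dist_eq]
  have h1 := S2_step hγ1 hγ2 hB hG hx hG0 ha hb hc hd hab hcd k (k + 1)
  have h2 := S2_step hγ2 hγ1 hB hG.swap hx.swap (fun t ht s hs => hG0 s hs t ht)
    hc hd ha hb hcd hab k k
  rw [S2_swap G x a b c d k (k + 1), S2_swap G x a b c d k k] at h2
  have := comb_aux (E := B ^ 2 + 4 * B ^ 3) (by positivity) (KK_pos hγ1).le (KK_pos hγ2).le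
    (by have : 0 ≤ B ^ 2 := by positivity
        linarith) h1 h2
  simpa [CC] using this

lemma DS_diff {F H : ℝ → ℝ → ℝ} {a b D : ℝ} (ha : a ∈ I01) (hb : b ∈ I01) (hab : a ≤ b)
    (h : ∀ s ∈ I01, ∀ s' ∈ I01, |F s s' - H s s'| ≤ D) (k : ℕ) :
    |DS F a b k - DS H a b k| ≤ 2 ^ k * D := by
  rw [DS_sub]
  unfold DS
  refine (Finset.abs_sum_le_sum_abs _ _).trans ?_
  have : ∀ i ∈ Finset.range (2 ^ k), |F (dyp a b k i) (dyp a b k (i + 1)) -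
      H (dyp a b k i) (dyp a b k (i + 1))| ≤ D := by
    intro i hi
    have hi := Finset.mem_range.1 hi
    exact h _ (dyp_mem ha hb hab (by omega)) _ (dyp_mem ha hb hab (by omega))
  refine (Finset.sum_le_sum this).trans ?_
  simp

lemma Hol.b1 {γ1 γ2 B : ℝ} {f : ℝ → ℝ → ℝ} (h : Hol γ1 γ2 B f) (hB : 0 ≤ B) (hγ : 1 / 2 < γ1)
    {s s' t : ℝ} (hs : s ∈ I01) (hs' : s' ∈ I01) (ht : t ∈ I01) : |f s' t - f s t| ≤ B :=
  (h.h1 s hs s' hs' t ht).trans (by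
    have := rpow_le_one' hs hs' hγ
    nlinarith)

lemma S1_diff {γ1 γ2 B η a b c d : ℝ} {G x G' x' : ℝ → ℝ → ℝ} (hγ1 : 1 / 2 < γ1)
    (hB : 0 ≤ B) (hη : 0 ≤ η) (hx : Hol γ1 γ2 B x)
    (hG0 : ∀ s ∈ I01, ∀ t ∈ I01, |G' s t| ≤ B)
    (hGG : ∀ s ∈ I01, ∀ t ∈ I01, |G s t - G' s t| ≤ η)
    (hxx : ∀ s ∈ I01, ∀ t ∈ I01, |x s t - x' s t| ≤ η)
    (ha : a ∈ I01) (hb : b ∈ I01) (hc : c ∈ I01) (hd : d ∈ I01) (hab : a ≤ b) (hcd : c ≤ d)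
    (k l : ℕ) :
    |S1 G x a b c d k l - S1 G' x' a b c d k l| ≤ 2 ^ k * (2 ^ l * (6 * B * η)) := by
  unfold S1
  refine DS_diff ha hb hab (fun s hs s' hs' => DS_diff hc hd hcd (fun t ht t' ht' => ?_) l) k
  have u1 := hx.b1 hB hγ1 hs hs' ht
  have u2 := hx.b1 hB hγ1 hs hs' ht'
  have e : G s t * dRect x s s' t t' - G' s t * dRect x' s s' t t' =
    (G s t - G' s t) * ((x s' t' - x s t') - (x s' t - x s t)) +
    G' s t * (((x s' t' - x' s' t') - (x s t' - x' s t')) -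
      ((x s' t - x' s' t) - (x s t - x' s t))) := by
    unfold dRect; ring
  rw [e]
  have v1 : |(x s' t' - x s t') - (x s' t - x s t)| ≤ 2 * B :=
    (abs_sub _ _).trans (by linarith)
  have v2 : |((x s' t' - x' s' t') - (x s t' - x' s t')) -
      ((x s' t - x' s' t) - (x s t - x' s t))| ≤ 4 * η := by
    have w1 := hxx s' hs' t' ht'
    have w2 := hxx s hs t' ht'
    have w3 := hxx s' hs' t ht
    have w4 := hxx s hs t ht
    rw [abs_le] at *
    constructor <;> linarith
  have y1 := hGG s hs t ht
  have y2 := hG0 s hs t ht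
  refine (abs_add_le _ _).trans ?_
  rw [abs_mul, abs_mul]
  calc _ ≤ η * (2 * B) + B * (4 * η) := by gcongr
    _ = _ := by ring

lemma S2_diff {γ1 γ2 B η a b c d : ℝ} {G x G' x' : ℝ → ℝ → ℝ} (hγ1 : 1 / 2 < γ1)
    (hγ2 : 1 / 2 < γ2)
    (hB : 0 ≤ B) (hη : 0 ≤ η) (hx : Hol γ1 γ2 B x) (hx' : Hol γ1 γ2 B x')
    (hG0 : ∀ s ∈ I01, ∀ t ∈ I01, |G' s t| ≤ B)
    (hGG : ∀ s ∈ I01, ∀ t ∈ I01, |G s t - G' s t| ≤ η)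
    (hxx : ∀ s ∈ I01, ∀ t ∈ I01, |x s t - x' s t| ≤ η)
    (ha : a ∈ I01) (hb : b ∈ I01) (hc : c ∈ I01) (hd : d ∈ I01) (hab : a ≤ b) (hcd : c ≤ d)
    (k l : ℕ) :
    |S2 G x a b c d k l - S2 G' x' a b c d k l| ≤ 2 ^ k * (2 ^ l * (5 * B ^ 2 * η)) := by
  unfold S2
  refine DS_diff ha hb hab (fun s hs s' hs' => DS_diff hc hd hcd (fun t ht t' ht' => ?_) l) k
  have u1 := hx.b1 hB hγ1 hs hs' ht
  have u2 := hx.swap.b1 hB hγ2 ht ht' hs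
  have u3 := hx'.b1 hB hγ1 hs hs' ht
  have e : G s t * d1 x s s' t * d2 x s t t' - G' s t * d1 x' s s' t * d2 x' s t t' =
    (G s t - G' s t) * (x s' t - x s t) * (x s t' - x s t) +
    G' s t * ((x s' t - x' s' t) - (x s t - x' s t)) * (x s t' - x s t) +
    G' s t * (x' s' t - x' s t) * ((x s t' - x' s t') - (x s t - x' s t)) := by
    unfold d1 d2; ring
  rw [e]
  have w2 := hxx s hs t' ht'
  have w3 := hxx s' hs' t ht
  have w4 := hxx s hs t ht
  have v1 : |(x s' t - x' s' t) - (x s t - x' s t)| ≤ 2 * η :=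
    (abs_sub _ _).trans (by linarith)
  have v2 : |(x s t' - x' s t') - (x s t - x' s t)| ≤ 2 * η :=
    (abs_sub _ _).trans (by linarith)
  have y1 := hGG s hs t ht
  have y2 := hG0 s hs t ht
  refine (abs_add_le _ _).trans ((add_le_add_left (abs_add_le _ _) _).trans ?_)
  simp only [abs_mul]
  calc _ ≤ η * B * B + B * (2 * η) * B + B * B * (2 * η) := by gcongr
    _ = _ := by ring

lemma part_exists {a b : ℝ} (hab : a ≤ b) : ∃ m : ℕ → ℕ, IsPartSeq a b m (dyp a b) ∧
    ∀ (n : ℕ) (F : ℝ → ℝ → ℝ), (∀ s, F s s = 0) →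
      ∑ i ∈ Finset.range (m n), F (dyp a b n i) (dyp a b n (i + 1)) = DS F a b n := by
  rcases hab.eq_or_lt with h | h
  · subst h
    refine ⟨fun _ => 0, ⟨by simp [dyp], by simp [dyp], by simp, by simp⟩, ?_⟩
    intro n F hF
    simp [DS, dyp, hF]
  · refine ⟨fun n => 2 ^ n, ⟨by simp [dyp], by simp [dyp], ?_, ?_⟩, fun n F _ => rfl⟩
    · intro n i _
      rw [← sub_pos, dyp_step]
      have : 0 < b - a := by linarith
      positivity
    · intro ε hε
      have : Tendsto (fun n : ℕ => (b - a) / 2 ^ n) atTop (𝓝 0) :=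
        tendsto_const_nhds.div_atTop (tendsto_pow_atTop_atTop_of_one_lt (by norm_num))
      obtain ⟨N, hN⟩ := eventually_atTop.1 (this.eventually (gt_mem_nhds hε))
      refine ⟨N, fun n hn i _ => ?_⟩
      rw [dyp_step]
      exact hN n hn

/-- The two-dimensional limits, evaluated along dyadic partitions. -/
lemma z1_lim {a b c d z : ℝ} {G x : ℝ → ℝ → ℝ} (hab : a ≤ b) (hcd : c ≤ d)
    (h : ∀ (m m' : ℕ → ℕ) (σ τ : ℕ → ℕ → ℝ),
        IsPartSeq a b m σ → IsPartSeq c d m' τ →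
        Tendsto (fun n => ∑ i ∈ Finset.range (m n), ∑ j ∈ Finset.range (m' n),
            G (σ n i) (τ n j) *
              dRect x (σ n i) (σ n (i + 1)) (τ n j) (τ n (j + 1)))
          atTop (𝓝 z)) :
    Tendsto (fun n => S1 G x a b c d n n) atTop (𝓝 z) := by
  obtain ⟨m, hm, hm2⟩ := part_exists hab
  obtain ⟨m', hm', hm2'⟩ := part_exists hcd
  refine (h m m' _ _ hm hm').congr fun n => ?_
  unfold S1
  rw [← hm2 n]
  · refine Finset.sum_congr rfl fun i _ => ?_
    rw [← hm2' n]
    intro t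
    simp [dRect]
  · intro s
    simp [DS, dRect]

lemma z2_lim {a b c d z : ℝ} {G x : ℝ → ℝ → ℝ} (hab : a ≤ b) (hcd : c ≤ d)
    (h : ∀ (m m' : ℕ → ℕ) (σ τ : ℕ → ℕ → ℝ),
        IsPartSeq a b m σ → IsPartSeq c d m' τ →
        Tendsto (fun n => ∑ i ∈ Finset.range (m n), ∑ j ∈ Finset.range (m' n),
            G (σ n i) (τ n j) *
              d1 x (σ n i) (σ n (i + 1)) (τ n j) * d2 x (σ n i) (τ n j) (τ n (j + 1)))
          atTop (𝓝 z)) :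
    Tendsto (fun n => S2 G x a b c d n n) atTop (𝓝 z) := by
  obtain ⟨m, hm, hm2⟩ := part_exists hab
  obtain ⟨m', hm', hm2'⟩ := part_exists hcd
  refine (h m m' _ _ hm hm').congr fun n => ?_
  unfold S2
  rw [← hm2 n]
  · refine Finset.sum_congr rfl fun i _ => ?_
    rw [← hm2' n]
    intro t
    simp [d2]
  · intro s
    simp [DS, d1]

lemma lip_of {g g' : ℝ → ℝ} {C : ℝ} (hg : ∀ y, HasDerivAt g (g' y) y) (hC : ∀ y, |g' y| ≤ C)
    (u v : ℝ) : |g u - g v| ≤ C * |u - v| := by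
  have := Convex.norm_image_sub_le_of_norm_hasDerivWithin_le (s := univ) (f := g) (f' := g')
    (C := C) (x := v) (y := u) (fun y _ => (hg y).hasDerivWithinAt) (fun y _ => hC y) convex_univ
    (mem_univ _) (mem_univ _)
  simpa using this

lemma rect_comp {g g' g'' : ℝ → ℝ} {C : ℝ} (hg : ∀ y, HasDerivAt g (g' y) y)
    (hg' : ∀ y, HasDerivAt g' (g'' y) y) (hC1 : ∀ y, |g' y| ≤ C) (hC2 : ∀ y, |g'' y| ≤ C)
    {x11 x12 x21 x22 P : ℝ} (hC : 0 ≤ C)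
    (hP1 : |x12 - x11| ≤ P) (hP2 : |x22 - x21| ≤ P) :
    |g x22 - g x12 - g x21 + g x11| ≤
      C * |x22 - x12 - x21 + x11| + C * P * |x21 - x11| := by
  have hder : ∀ θ : ℝ, HasDerivAt
      (fun θ : ℝ => g (x12 + θ * (x22 - x12)) - g (x11 + θ * (x21 - x11)))
      (g' (x12 + θ * (x22 - x12)) * (x22 - x12) - g' (x11 + θ * (x21 - x11)) * (x21 - x11)) θ := by
    intro θ
    have i1 : HasDerivAt (fun θ : ℝ => x12 + θ * (x22 - x12)) (x22 - x12) θ := by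
      simpa using ((hasDerivAt_id θ).mul_const (x22 - x12)).const_add x12
    have i2 : HasDerivAt (fun θ : ℝ => x11 + θ * (x21 - x11)) (x21 - x11) θ := by
      simpa using ((hasDerivAt_id θ).mul_const (x21 - x11)).const_add x11
    exact ((hg _).comp θ i1).sub ((hg _).comp θ i2)
  have hP : 0 ≤ P := (abs_nonneg _).trans hP1
  have := Convex.norm_image_sub_le_of_norm_hasDerivWithin_le (s := Icc (0 : ℝ) 1)
    (C := C * |x22 - x12 - x21 + x11| + C * P * |x21 - x11|) (x := 0) (y := 1)
    (fun θ _ => (hder θ).hasDerivWithinAt) ?_ (convex_Icc _ _) (by simp) (by simp)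
  · simp only [Real.norm_eq_abs] at this
    ring_nf at this ⊢
    simpa using this
  · intro θ hθ
    rw [Real.norm_eq_abs]
    have e : g' (x12 + θ * (x22 - x12)) * (x22 - x12) - g' (x11 + θ * (x21 - x11)) * (x21 - x11) =
      g' (x12 + θ * (x22 - x12)) * (x22 - x12 - x21 + x11) +
      (g' (x12 + θ * (x22 - x12)) - g' (x11 + θ * (x21 - x11))) * (x21 - x11) := by ring
    rw [e]
    refine (abs_add_le _ _).trans ?_
    rw [abs_mul, abs_mul]
    have l := lip_of hg' hC2 (x12 + θ * (x22 - x12)) (x11 + θ * (x21 - x11))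
    have hh : |(x12 + θ * (x22 - x12)) - (x11 + θ * (x21 - x11))| ≤ P := by
      rw [abs_le] at *
      constructor <;> nlinarith [hθ.1, hθ.2]
    have l2 : C * |(x12 + θ * (x22 - x12)) - (x11 + θ * (x21 - x11))| ≤ C * P := by gcongr
    have l3 := l.trans l2
    have l4 := hC1 (x12 + θ * (x22 - x12))
    gcongr

lemma Hol.comp {γ1 γ2 B C : ℝ} {x : ℝ → ℝ → ℝ} {g g' g'' : ℝ → ℝ} (hx : Hol γ1 γ2 B x)
    (hB : 0 ≤ B) (hC : 0 ≤ C) (hg : ∀ y, HasDerivAt g (g' y) y)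
    (hg' : ∀ y, HasDerivAt g' (g'' y) y) (hC1 : ∀ y, |g' y| ≤ C) (hC2 : ∀ y, |g'' y| ≤ C) :
    Hol γ1 γ2 (C * B + C * B ^ 2) (fun s t => g (x s t)) where
  h1 := fun s hs s' hs' t ht => by
    refine (lip_of hg hC1 _ _).trans ?_
    have := hx.h1 s hs s' hs' t ht
    have r : 0 ≤ |s' - s| ^ γ1 := by positivity
    calc _ ≤ C * (B * |s' - s| ^ γ1) := by gcongr
      _ ≤ C * (B * |s' - s| ^ γ1) + C * B ^ 2 * |s' - s| ^ γ1 := by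
        have : 0 ≤ C * B ^ 2 * |s' - s| ^ γ1 := by positivity
        linarith
      _ = _ := by ring
  h2 := fun s hs t ht t' ht' => by
    refine (lip_of hg hC1 _ _).trans ?_
    have := hx.h2 s hs t ht t' ht'
    calc _ ≤ C * (B * |t' - t| ^ γ2) := by gcongr
      _ ≤ C * (B * |t' - t| ^ γ2) + C * B ^ 2 * |t' - t| ^ γ2 := by
        have : 0 ≤ C * B ^ 2 * |t' - t| ^ γ2 := by positivity
        linarith
      _ = _ := by ring
  hr := fun s hs s' hs' t ht t' ht' => by
    have := rect_comp hg hg' hC1 hC2 hC (hx.h2 s hs t ht t' ht') (hx.h2 s' hs' t ht t' ht')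
    unfold dRect
    refine this.trans ?_
    have a1 := hx.hr s hs s' hs' t ht t' ht'
    unfold dRect at a1
    have a2 := hx.h1 s hs s' hs' t ht
    calc _ ≤ C * (B * (|s' - s| ^ γ1 * |t' - t| ^ γ2)) +
          C * (B * |t' - t| ^ γ2) * (B * |s' - s| ^ γ1) := by gcongr
      _ = _ := by ring

lemma le_of_ofReal_div {u v B : ℝ} (hB : 0 ≤ B) (hv : 0 ≤ v) (h0 : v = 0 → u = 0)
    (h : ENNReal.ofReal (u / v) ≤ ENNReal.ofReal B) : u ≤ B * v := by
  rw [ENNReal.ofReal_le_ofReal_iff hB] at h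
  rcases hv.eq_or_lt with h1 | h1
  · rw [h0 h1.symm, ← h1]; simp
  · exact (div_le_iff₀ h1).1 h

lemma abs_rpow_eq_zero {s s' γ : ℝ} (h : |s' - s| ^ γ = 0) : s' = s := by
  rw [Real.rpow_eq_zero_iff_of_nonneg (abs_nonneg _)] at h
  exact sub_eq_zero.1 (abs_eq_zero.1 h.1)

lemma Hol_of_NN {γ1 γ2 B : ℝ} {x : ℝ → ℝ → ℝ} (hB : 0 ≤ B)
    (h : NN γ1 γ2 x ≤ ENNReal.ofReal B) : Hol γ1 γ2 B x := by
  have n1 : holRect γ1 γ2 x ≤ NN γ1 γ2 x := by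
    unfold NN; rw [add_assoc, add_assoc]; exact le_self_add
  have n2 : hol1 γ1 x ≤ NN γ1 γ2 x := by
    unfold NN; rw [add_assoc, add_comm (holRect γ1 γ2 x), add_assoc]; exact le_self_add
  have n3 : hol2 γ2 x ≤ NN γ1 γ2 x := by
    unfold NN; rw [add_comm _ (hol2 γ2 x), add_assoc]; exact le_self_add
  refine ⟨?_, ?_, ?_⟩
  · intro s hs s' hs' t ht
    refine le_of_ofReal_div hB (by positivity) ?_ (le_trans ?_ (n2.trans h))
    · intro e; rw [abs_rpow_eq_zero e]; simp
    · exact le_iSup_of_le (⟨s, hs⟩ : I01) (le_iSup_of_le (⟨s', hs'⟩ : I01)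
        (le_iSup_of_le (⟨t, ht⟩ : I01) le_rfl))
  · intro s hs t ht t' ht'
    refine le_of_ofReal_div hB (by positivity) ?_ (le_trans ?_ (n3.trans h))
    · intro e; rw [abs_rpow_eq_zero e]; simp
    · exact le_iSup_of_le (⟨s, hs⟩ : I01) (le_iSup_of_le (⟨t, ht⟩ : I01)
        (le_iSup_of_le (⟨t', ht'⟩ : I01) le_rfl))
  · intro s hs s' hs' t ht t' ht'
    refine le_of_ofReal_div hB (by positivity) ?_ (le_trans ?_ (n1.trans h))
    · intro e
      rcases mul_eq_zero.1 e with e | e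
      · rw [abs_rpow_eq_zero e]; simp [dRect]
      · rw [abs_rpow_eq_zero e]; simp [dRect]
    · exact le_iSup_of_le (⟨s, hs⟩ : I01) (le_iSup_of_le (⟨s', hs'⟩ : I01)
        (le_iSup_of_le (⟨t, ht⟩ : I01) (le_iSup_of_le (⟨t', ht'⟩ : I01) le_rfl)))

lemma sup_of_NN {γ1 γ2 δ : ℝ} {x : ℝ → ℝ → ℝ} (hδ : 0 ≤ δ)
    (h : NN γ1 γ2 x ≤ ENNReal.ofReal δ) : ∀ s ∈ I01, ∀ t ∈ I01, |x s t| ≤ δ := by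
  intro s hs t ht
  have n1 : holInf x ≤ NN γ1 γ2 x := by
    unfold NN; exact le_add_self
  rw [← ENNReal.ofReal_le_ofReal_iff hδ]
  refine le_trans ?_ (n1.trans h)
  unfold holInf
  exact le_iSup_of_le (⟨s, hs⟩ : I01) (le_iSup_of_le (f := fun t : I01 => ENNReal.ofReal |x s t|)
    (⟨t, ht⟩ : I01) le_rfl)

lemma Hol_lim {γ1 γ2 B : ℝ} {x : ℝ → ℝ → ℝ} {xs : ℕ → ℝ → ℝ → ℝ} (h : ∀ n, Hol γ1 γ2 B (xs n))
    (hl : ∀ s ∈ I01, ∀ t ∈ I01, Tendsto (fun n => xs n s t) atTop (𝓝 (x s t))) :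
    Hol γ1 γ2 B x where
  h1 := fun s hs s' hs' t ht =>
    le_of_tendsto' ((hl s' hs' t ht).sub (hl s hs t ht)).abs fun n => (h n).h1 s hs s' hs' t ht
  h2 := fun s hs t ht t' ht' =>
    le_of_tendsto' ((hl s hs t' ht').sub (hl s hs t ht)).abs fun n => (h n).h2 s hs t ht t' ht'
  hr := fun s hs s' hs' t ht t' ht' =>
    le_of_tendsto' ((((hl s' hs' t' ht').sub (hl s hs t' ht')).sub (hl s' hs' t ht)).add
      (hl s hs t ht)).abs fun n => (h n).hr s hs s' hs' t ht t' ht'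

theorem continuity_of_planar_young_integrals
    (γ1 γ2 : ℝ) (hγ1 : 1 / 2 < γ1) (hγ2 : 1 / 2 < γ2)
    (φ : ℝ → ℝ) (hφ : ContDiff ℝ 4 φ)
    (hφbd : ∀ l : ℕ, l ≤ 4 → ∃ C : ℝ, ∀ ξ : ℝ, |iteratedDeriv l φ ξ| ≤ C)
    (x : ℝ → ℝ → ℝ) (xs : ℕ → ℝ → ℝ → ℝ)
    (hxc : ContinuousOn (fun p : ℝ × ℝ => x p.1 p.2) (I01 ×ˢ I01))
    (hxsc : ∀ n, ContinuousOn (fun p : ℝ × ℝ => xs n p.1 p.2) (I01 ×ˢ I01))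
    (hbdd : ∃ B : ℝ, ∀ n, NN γ1 γ2 (xs n) ≤ ENNReal.ofReal B)
    (hconv : Tendsto (fun n => NN γ1 γ2 (fun s t => xs n s t - x s t)) atTop (𝓝 0))
    (z1 z2 : ℝ → ℝ → ℝ → ℝ → ℝ) (z1n z2n : ℕ → ℝ → ℝ → ℝ → ℝ → ℝ)
    (hz1 : ∀ s1 ∈ I01, ∀ s2 ∈ I01, ∀ t1 ∈ I01, ∀ t2 ∈ I01, s1 ≤ s2 → t1 ≤ t2 →
      ∀ (m m' : ℕ → ℕ) (σ τ : ℕ → ℕ → ℝ),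
        IsPartSeq s1 s2 m σ → IsPartSeq t1 t2 m' τ →
        Tendsto (fun n => ∑ i ∈ Finset.range (m n), ∑ j ∈ Finset.range (m' n),
            deriv φ (x (σ n i) (τ n j)) *
              dRect x (σ n i) (σ n (i + 1)) (τ n j) (τ n (j + 1)))
          atTop (𝓝 (z1 s1 s2 t1 t2)))
    (hz2 : ∀ s1 ∈ I01, ∀ s2 ∈ I01, ∀ t1 ∈ I01, ∀ t2 ∈ I01, s1 ≤ s2 → t1 ≤ t2 →
      ∀ (m m' : ℕ → ℕ) (σ τ : ℕ → ℕ → ℝ),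
        IsPartSeq s1 s2 m σ → IsPartSeq t1 t2 m' τ →
        Tendsto (fun n => ∑ i ∈ Finset.range (m n), ∑ j ∈ Finset.range (m' n),
            deriv (deriv φ) (x (σ n i) (τ n j)) *
              d1 x (σ n i) (σ n (i + 1)) (τ n j) * d2 x (σ n i) (τ n j) (τ n (j + 1)))
          atTop (𝓝 (z2 s1 s2 t1 t2)))
    (hz1n : ∀ k : ℕ, ∀ s1 ∈ I01, ∀ s2 ∈ I01, ∀ t1 ∈ I01, ∀ t2 ∈ I01, s1 ≤ s2 → t1 ≤ t2 →
      ∀ (m m' : ℕ → ℕ) (σ τ : ℕ → ℕ → ℝ),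
        IsPartSeq s1 s2 m σ → IsPartSeq t1 t2 m' τ →
        Tendsto (fun n => ∑ i ∈ Finset.range (m n), ∑ j ∈ Finset.range (m' n),
            deriv φ (xs k (σ n i) (τ n j)) *
              dRect (xs k) (σ n i) (σ n (i + 1)) (τ n j) (τ n (j + 1)))
          atTop (𝓝 (z1n k s1 s2 t1 t2)))
    (hz2n : ∀ k : ℕ, ∀ s1 ∈ I01, ∀ s2 ∈ I01, ∀ t1 ∈ I01, ∀ t2 ∈ I01, s1 ≤ s2 → t1 ≤ t2 →
      ∀ (m m' : ℕ → ℕ) (σ τ : ℕ → ℕ → ℝ),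
        IsPartSeq s1 s2 m σ → IsPartSeq t1 t2 m' τ →
        Tendsto (fun n => ∑ i ∈ Finset.range (m n), ∑ j ∈ Finset.range (m' n),
            deriv (deriv φ) (xs k (σ n i) (τ n j)) *
              d1 (xs k) (σ n i) (σ n (i + 1)) (τ n j) *
              d2 (xs k) (σ n i) (τ n j) (τ n (j + 1)))
          atTop (𝓝 (z2n k s1 s2 t1 t2))) :
    ∀ ε : ℝ, 0 < ε → ∃ N : ℕ, ∀ n ≥ N,
      ∀ s1 ∈ I01, ∀ s2 ∈ I01, ∀ t1 ∈ I01, ∀ t2 ∈ I01, s1 ≤ s2 → t1 ≤ t2 →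
        |z1n n s1 s2 t1 t2 - z1 s1 s2 t1 t2| < ε ∧
        |z2n n s1 s2 t1 t2 - z2 s1 s2 t1 t2| < ε := by
  obtain ⟨B0, hB0⟩ := hbdd
  have hd : ∀ l : ℕ, l < 4 → ∀ y, HasDerivAt (iteratedDeriv l φ) (iteratedDeriv (l + 1) φ y) y := by
    intro l hl y
    rw [iteratedDeriv_succ]
    exact ((hφ.differentiable_iteratedDeriv l (by exact_mod_cast hl)) y).hasDerivAt
  obtain ⟨C, hC, hCb⟩ : ∃ C : ℝ, 0 ≤ C ∧ ∀ l ≤ 4, ∀ y, |iteratedDeriv l φ y| ≤ C := by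
    choose! c hc using hφbd
    refine ⟨∑ l ∈ Finset.range 5, |c l|, by positivity, fun l hl y => ?_⟩
    refine (hc l hl y).trans ((le_abs_self _).trans ?_)
    exact Finset.single_le_sum (f := fun l => |c l|) (fun _ _ => abs_nonneg _)
      (Finset.mem_range.2 (by omega))
  have e1 : deriv φ = iteratedDeriv 1 φ := iteratedDeriv_one.symm
  have e2 : deriv (deriv φ) = iteratedDeriv 2 φ := by
    rw [e1]; exact (iteratedDeriv_succ (n := 1)).symm
  rw [e1] at hz1 hz1n e2
  simp only [e1, e2] at hz2 hz2n
  set B1 := max B0 0 with hB1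
  have hB1p : 0 ≤ B1 := le_max_right _ _
  have hxsH1 : ∀ n, Hol γ1 γ2 B1 (xs n) := fun n =>
    Hol_of_NN hB1p ((hB0 n).trans (ENNReal.ofReal_le_ofReal (le_max_left _ _)))
  have hsup : ∀ δ : ℝ, 0 < δ → ∃ N : ℕ, ∀ n ≥ N, ∀ s ∈ I01, ∀ t ∈ I01,
      |xs n s t - x s t| ≤ δ := by
    intro δ hδ
    have := hconv.eventually (gt_mem_nhds (ENNReal.ofReal_pos.2 hδ))
    obtain ⟨N, hN⟩ := eventually_atTop.1 this
    exact ⟨N, fun n hn => sup_of_NN hδ.le (hN n hn).le⟩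
  have hxH1 : Hol γ1 γ2 B1 x := by
    refine Hol_lim hxsH1 fun s hs t ht => ?_
    rw [Metric.tendsto_atTop]
    intro ε hε
    obtain ⟨N, hN⟩ := hsup (ε / 2) (by linarith)
    refine ⟨N, fun n hn => ?_⟩
    rw [Real.dist_eq]
    have := hN n hn s hs t ht
    linarith
  set B := B1 + C + (C * B1 + C * B1 ^ 2) with hB
  have hp : 0 ≤ C * B1 + C * B1 ^ 2 := by positivity
  have hBp : 0 ≤ B := by positivity
  have hCB : C ≤ B := by linarith
  have hcomp : ∀ y : ℝ → ℝ → ℝ, Hol γ1 γ2 B1 y → ∀ l, l < 3 →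
      Hol γ1 γ2 B (fun s t => iteratedDeriv l φ (y s t)) := by
    intro y hy l hl
    exact (hy.comp hB1p hC (hd l (by omega)) (hd (l + 1) (by omega)) (hCb _ (by omega))
      (hCb _ (by omega))).mono (by linarith)
  have hbdG : ∀ y : ℝ → ℝ → ℝ, ∀ l, l < 3 → ∀ s ∈ I01, ∀ t ∈ I01,
      |iteratedDeriv l φ (y s t)| ≤ B := fun y l hl s _ t _ => (hCb l (by omega) _).trans hCB
  have hxsH : ∀ n, Hol γ1 γ2 B (xs n) := fun n => (hxsH1 n).mono (by linarith)
  have hxH : Hol γ1 γ2 B x := hxH1.mono (by linarith)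
  have hQ1 : QQ γ1 γ2 < 1 := max_lt (qq_lt_one hγ1) (qq_lt_one hγ2)
  have hQ0 : 0 < QQ γ1 γ2 := lt_max_of_lt_left (qq_pos _)
  intro ε hε
  -- choice of the level
  have hlev : Tendsto (fun k : ℕ => CC γ1 γ2 B * QQ γ1 γ2 ^ k / (1 - QQ γ1 γ2)) atTop (𝓝 0) := by
    have := ((tendsto_pow_atTop_nhds_zero_of_lt_one hQ0.le hQ1).const_mul
      (CC γ1 γ2 B)).div_const (1 - QQ γ1 γ2)
    simpa using this
  obtain ⟨k, hk⟩ := (hlev.eventually (gt_mem_nhds (show (0 : ℝ) < ε / 3 by linarith))).exists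
  -- choice of the sup distance
  obtain ⟨W, hW, hW1, hW2⟩ : ∃ W : ℝ, 0 < W ∧ 2 ^ k * (2 ^ k * (6 * B)) ≤ W ∧
      2 ^ k * (2 ^ k * (5 * B ^ 2)) ≤ W := by
    refine ⟨1 + 2 ^ k * (2 ^ k * (6 * B)) + 2 ^ k * (2 ^ k * (5 * B ^ 2)), by positivity, ?_, ?_⟩
    · have : 0 ≤ (2 : ℝ) ^ k * (2 ^ k * (5 * B ^ 2)) := by positivity
      linarith
    · have : 0 ≤ (2 : ℝ) ^ k * (2 ^ k * (6 * B)) := by positivity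
      linarith
  set η := ε / 6 / W with hη
  have hηp : 0 < η := by positivity
  have hWη : W * η < ε / 3 := by
    rw [hη, mul_div_cancel₀ _ hW.ne']
    linarith
  obtain ⟨N, hN⟩ := hsup (η / (1 + C)) (by positivity)
  refine ⟨N, fun n hn s1 hs1 s2 hs2 t1 ht1 t2 ht2 hs ht => ?_⟩
  have hxx : ∀ s ∈ I01, ∀ t ∈ I01, |xs n s t - x s t| ≤ η := fun s hs t ht =>
    (hN n hn s hs t ht).trans (div_le_self hηp.le (by linarith))
  have hGG : ∀ l, l < 3 → ∀ s ∈ I01, ∀ t ∈ I01,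
      |iteratedDeriv l φ (xs n s t) - iteratedDeriv l φ (x s t)| ≤ η := by
    intro l hl s hs t ht
    refine (lip_of (hd l (by omega)) (hCb (l + 1) (by omega)) _ _).trans ?_
    calc C * |xs n s t - x s t| ≤ (1 + C) * (η / (1 + C)) := by
          have := hN n hn s hs t ht
          gcongr
          linarith
      _ = η := by field_simp
  have tri : ∀ a b c d : ℝ, dist a b ≤ CC γ1 γ2 B * QQ γ1 γ2 ^ k / (1 - QQ γ1 γ2) →
      dist c d ≤ CC γ1 γ2 B * QQ γ1 γ2 ^ k / (1 - QQ γ1 γ2) → |a - c| ≤ W * η → |b - d| < ε := by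
    intro a b c d h1 h2 h3
    rw [Real.dist_eq] at h1 h2
    have h1 := abs_le.1 h1
    have h2 := abs_le.1 h2
    have h3 := abs_le.1 h3
    rw [abs_lt]
    constructor <;> linarith
  constructor
  · refine tri _ _ _ _
      (dist_le_of_le_geometric_of_tendsto _ _ hQ1
        (fun j => S1_diag hγ1 hγ2 hBp (hcomp _ (hxsH1 n) 1 (by norm_num)) (hxsH n)
          hs1 hs2 ht1 ht2 hs ht j)
        (z1_lim hs ht (hz1n n s1 hs1 s2 hs2 t1 ht1 t2 ht2 hs ht)) k)
      (dist_le_of_le_geometric_of_tendsto _ _ hQ1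
        (fun j => S1_diag hγ1 hγ2 hBp (hcomp _ hxH1 1 (by norm_num)) hxH
          hs1 hs2 ht1 ht2 hs ht j)
        (z1_lim hs ht (hz1 s1 hs1 s2 hs2 t1 ht1 t2 ht2 hs ht)) k) ?_
    refine (S1_diff hγ1 hBp hηp.le (hxsH n) (hbdG x 1 (by norm_num)) (hGG 1 (by norm_num)) hxx
      hs1 hs2 ht1 ht2 hs ht k k).trans ?_
    have := mul_le_mul_of_nonneg_right hW1 hηp.le
    linarith
  · refine tri _ _ _ _
      (dist_le_of_le_geometric_of_tendsto _ _ hQ1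
        (fun j => S2_diag hγ1 hγ2 hBp (hcomp _ (hxsH1 n) 2 (by norm_num)) (hxsH n)
          (hbdG _ 2 (by norm_num)) hs1 hs2 ht1 ht2 hs ht j)
        (z2_lim hs ht (hz2n n s1 hs1 s2 hs2 t1 ht1 t2 ht2 hs ht)) k)
      (dist_le_of_le_geometric_of_tendsto _ _ hQ1
        (fun j => S2_diag hγ1 hγ2 hBp (hcomp _ hxH1 2 (by norm_num)) hxH
          (hbdG _ 2 (by norm_num)) hs1 hs2 ht1 ht2 hs ht j)
        (z2_lim hs ht (hz2 s1 hs1 s2 hs2 t1 ht1 t2 ht2 hs ht)) k) ?_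
    refine (S2_diff hγ1 hγ2 hBp hηp.le (hxsH n) hxH (hbdG x 2 (by norm_num))
      (hGG 2 (by norm_num)) hxx hs1 hs2 ht1 ht2 hs ht k k).trans ?_
    have := mul_le_mul_of_nonneg_right hW2 hηp.le
    linarith
end
end

section
/- (Rate of convergence of two-dimensional Young Riemann sums.) Let α_1, α_2 > 1/2 and let x, y : [0,1]^2 → ℝ be continuous with N_{α_1,α_2}(x) < ∞ and N_{α_1,α_2}(y) < ∞. Then for every rectangle [s_1,s_2] × [t_1,t_2] ⊆ [0,1]^2 the two-dimensional Young integral z_{s_1 s_2;t_1 t_2} = lim Σ_{i,j} y(σ_i,τ_j) δx_{σ_i σ_{i+1};τ_j τ_{j+1}} (limit over grid partitions with mesh tending to 0) exists, and there is a constant C, depending only on α_1, α_2, such that for every grid partition of [s_1,s_2] × [t_1,t_2] with meshes |π_1| = max_i (σ_{i+1}-σ_i) and |π_2| = max_j (τ_{j+1}-τ_j), |z_{s_1 s_2;t_1 t_2} - Σ_{i,j} y(σ_i,τ_j) δx_{σ_i σ_{i+1};τ_j τ_{j+1}}| ≤ C · N_{α_1,α_2}(y) · N_{α_1,α_2}(x)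 · (|π_1|^{2α_1 - 1} + |π_2|^{2α_2 - 1}). -/
open Set Filter
open scoped ENNReal Topology

noncomputable section

/-- The sewing constant. -/
def sewC (θ : ℝ) : ℝ := 2 / (1 - 2 ^ (1 - θ))

lemma sewC_den_pos {θ : ℝ} (h : 1 < θ) : 0 < 1 - (2 : ℝ) ^ (1 - θ) := by
  have : (2 : ℝ) ^ (1 - θ) < 1 := Real.rpow_lt_one_of_one_lt_of_neg (by norm_num) (by linarith)
  linarith

lemma sewC_nonneg {θ : ℝ} (h : 1 < θ) : 0 ≤ sewC θ :=
  div_nonneg (by norm_num) (sewC_den_pos h).le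

lemma sewC_eq {θ : ℝ} (h : 1 < θ) : 2 * (sewC θ * (1 / 2) ^ θ) + 2 = sewC θ := by
  have h0 := sewC_den_pos h
  have e : (2 : ℝ) ^ (1 - θ) = 2 * (1 / 2) ^ θ := by
    rw [Real.rpow_sub (by norm_num), Real.rpow_one, one_div, Real.inv_rpow (by norm_num)]
    rfl
  unfold sewC
  rw [e] at h0 ⊢
  field_simp
  ring

lemma exists_split (ρ : ℕ → ℝ) (hρ : Monotone ρ) (p q : ℕ) (hpq : p < q) :
    ∃ k, p ≤ k ∧ k < q ∧ ρ k - ρ p ≤ (ρ q - ρ p) / 2 ∧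
      ρ q - ρ (k + 1) ≤ (ρ q - ρ p) / 2 := by
  classical
  have hL : 0 ≤ ρ q - ρ p := sub_nonneg.2 (hρ hpq.le)
  have hex : ∃ k, p ≤ k ∧ (ρ q - ρ p) / 2 ≤ ρ (k + 1) - ρ p := by
    refine ⟨q - 1, by omega, ?_⟩
    have : q - 1 + 1 = q := by omega
    rw [this]; linarith
  have hs := Nat.find_spec hex
  have hle : Nat.find hex ≤ q - 1 := by
    apply Nat.find_min' hex
    refine ⟨by omega, ?_⟩
    have : q - 1 + 1 = q := by omega
    rw [this]; linarith
  have hm := fun {m : ℕ} => @Nat.find_min _ _ hex m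
  generalize Nat.find hex = k at *
  refine ⟨k, hs.1, by omega, ?_, by linarith [hs.2]⟩
  rcases hs.1.eq_or_lt with h | h
  · subst h; simp only [sub_self]; linarith
  · have := @hm (k - 1) (by omega)
    have e : k - 1 + 1 = k := by omega
    rw [e] at this
    by_contra hc
    exact this ⟨by omega, by linarith⟩

lemma sewing (θ K : ℝ) (hθ : 1 < θ) (hK : 0 ≤ K) (A : ℝ → ℝ → ℝ)
    (hA0 : ∀ s, A s s = 0)
    (hA : ∀ s ∈ I01, ∀ u ∈ I01, ∀ t ∈ I01, s ≤ u → u ≤ t →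
      |A s t - A s u - A u t| ≤ K * (t - s) ^ θ)
    (ρ : ℕ → ℝ) (hρ : Monotone ρ) (hI : ∀ i, ρ i ∈ I01) :
    ∀ N p q : ℕ, p ≤ q → q - p ≤ N →
      |∑ i ∈ Finset.Ico p q, A (ρ i) (ρ (i + 1)) - A (ρ p) (ρ q)|
        ≤ sewC θ * K * (ρ q - ρ p) ^ θ := by
  have hc := sewC_nonneg hθ
  intro N
  induction N with
  | zero =>
    intro p q hpq hN
    have : p = q := by omega
    subst this
    simp only [Finset.Ico_self, Finset.sum_empty, hA0, sub_self, abs_zero]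
    positivity
  | succ N ih =>
    intro p q hpq hN
    rcases hpq.eq_or_lt with h | h
    · subst h
      simp only [Finset.Ico_self, Finset.sum_empty, hA0, sub_self, abs_zero]
      positivity
    obtain ⟨k, hpk, hkq, h1, h2⟩ := exists_split ρ hρ p q h
    have i1 := ih p k hpk (by omega)
    have i2 := ih (k + 1) q (by omega) (by omega)
    have hL : 0 ≤ ρ q - ρ p := sub_nonneg.2 (hρ hpq)
    have hhalf : ((ρ q - ρ p) / 2) ^ θ = (1 / 2) ^ θ * (ρ q - ρ p) ^ θ := by
      rw [← Real.mul_rpow (by norm_num) hL]; congr 1; ring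
    have j1 : (ρ k - ρ p) ^ θ ≤ (1 / 2) ^ θ * (ρ q - ρ p) ^ θ := by
      rw [← hhalf]
      exact Real.rpow_le_rpow (sub_nonneg.2 (hρ hpk)) h1 (by linarith)
    have j2 : (ρ q - ρ (k + 1)) ^ θ ≤ (1 / 2) ^ θ * (ρ q - ρ p) ^ θ := by
      rw [← hhalf]
      exact Real.rpow_le_rpow (sub_nonneg.2 (hρ hkq)) h2 (by linarith)
    have d1 := hA _ (hI p) _ (hI k) _ (hI q) (hρ hpk) (hρ hkq.le)
    have d2 := hA _ (hI k) _ (hI (k + 1)) _ (hI q) (hρ (Nat.le_succ k)) (hρ hkq)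
    have j3 : (ρ q - ρ k) ^ θ ≤ (ρ q - ρ p) ^ θ :=
      Real.rpow_le_rpow (sub_nonneg.2 (hρ hkq.le)) (by linarith [hρ hpk]) (by linarith)
    have hs : ∑ i ∈ Finset.Ico p q, A (ρ i) (ρ (i + 1)) =
        ∑ i ∈ Finset.Ico p k, A (ρ i) (ρ (i + 1)) + A (ρ k) (ρ (k + 1)) +
          ∑ i ∈ Finset.Ico (k + 1) q, A (ρ i) (ρ (i + 1)) := by
      rw [← Finset.sum_Ico_consecutive _ hpk hkq.le, Finset.sum_eq_sum_Ico_succ_bot hkq]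
      ring
    rw [hs]
    have cK : 0 ≤ sewC θ * K := mul_nonneg hc hK
    have j1' := mul_le_mul_of_nonneg_left j1 cK
    have j2' := mul_le_mul_of_nonneg_left j2 cK
    have j3' := mul_le_mul_of_nonneg_left j3 hK
    have e : sewC θ * K * (ρ q - ρ p) ^ θ =
        2 * (sewC θ * K * ((1 / 2) ^ θ * (ρ q - ρ p) ^ θ)) + 2 * (K * (ρ q - ρ p) ^ θ) := by
      nth_rewrite 1 [← sewC_eq hθ]; ring
    rw [e]
    rw [abs_le] at *
    constructor <;> linarith [i1.1, i1.2, i2.1, i2.2, d1.1, d1.2, d2.1, d2.2]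

lemma sewing_range (θ K : ℝ) (hθ : 1 < θ) (hK : 0 ≤ K) (A : ℝ → ℝ → ℝ)
    (hA0 : ∀ s, A s s = 0)
    (hA : ∀ s ∈ I01, ∀ u ∈ I01, ∀ t ∈ I01, s ≤ u → u ≤ t →
      |A s t - A s u - A u t| ≤ K * (t - s) ^ θ)
    (ρ : ℕ → ℝ) (hρ : Monotone ρ) (hI : ∀ i, ρ i ∈ I01) (n : ℕ) :
    |∑ i ∈ Finset.range n, A (ρ i) (ρ (i + 1)) - A (ρ 0) (ρ n)|
        ≤ sewC θ * K * (ρ n - ρ 0) ^ θ := by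
  have := sewing θ K hθ hK A hA0 hA ρ hρ hI n 0 n (Nat.zero_le _) (by omega)
  rwa [← Finset.range_eq_Ico] at this

lemma clamp_swap (A : ℝ → ℝ → ℝ) (hA0 : ∀ s, A s s = 0) (l u p q : ℝ) (hlu : l ≤ u)
    (hpq : p ≤ q) :
    A (max l (min u p)) (max l (min u q)) = A (max p (min q l)) (max p (min q u)) := by
  rcases le_or_gt u p with h | h
  · rw [min_eq_left h, min_eq_left (h.trans hpq), min_eq_right ((hlu.trans h).trans hpq),
      min_eq_right (h.trans hpq), max_eq_left (hlu.trans h), max_eq_left h, hA0, hA0]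
  rcases le_or_gt q l with h' | h'
  · rw [min_eq_left h', min_eq_left (h'.trans hlu), min_eq_right ((hpq.trans h').trans hlu),
      min_eq_right (h'.trans hlu), max_eq_left (hpq.trans h'), max_eq_left h', hA0, hA0]
  rw [min_eq_right h.le, min_eq_right h'.le, max_comm l p, min_comm u q,
    max_eq_right (le_min h'.le hlu), max_eq_right (le_min hpq h.le)]

lemma half_compare (θ K : ℝ) (hθ : 1 < θ) (hK : 0 ≤ K) (A : ℝ → ℝ → ℝ)
    (hA0 : ∀ s, A s s = 0)
    (hA : ∀ s ∈ I01, ∀ u ∈ I01, ∀ t ∈ I01, s ≤ u → u ≤ t →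
      |A s t - A s u - A u t| ≤ K * (t - s) ^ θ)
    (σ τ : ℕ → ℝ) (hσ : Monotone σ) (hτ : Monotone τ) (hσI : ∀ i, σ i ∈ I01)
    (hτI : ∀ i, τ i ∈ I01) (m n : ℕ) (h0 : σ 0 = τ 0) (h1 : σ m = τ n)
    (μ : ℝ) (hμ0 : 0 ≤ μ) (hμ : ∀ i < m, σ (i + 1) - σ i ≤ μ) :
    |∑ i ∈ Finset.range m, ∑ j ∈ Finset.range n,
        A (max (σ i) (min (σ (i + 1)) (τ j))) (max (σ i) (min (σ (i + 1)) (τ (j + 1)))) -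
      ∑ i ∈ Finset.range m, A (σ i) (σ (i + 1))| ≤ sewC θ * K * μ ^ (θ - 1) := by
  have cK : 0 ≤ sewC θ * K := mul_nonneg (sewC_nonneg hθ) hK
  rw [← Finset.sum_sub_distrib]
  calc _ ≤ ∑ i ∈ Finset.range m, sewC θ * K * μ ^ (θ - 1) * (σ (i + 1) - σ i) := by
        refine (Finset.abs_sum_le_sum_abs _ _).trans (Finset.sum_le_sum fun i hi => ?_)
        rw [Finset.mem_range] at hi
        have hle := hσ (Nat.le_succ i)
        have := sewing_range θ K hθ hK A hA0 hA
          (fun j => max (σ i) (min (σ (i + 1)) (τ j)))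
          (fun a b hab => max_le_max le_rfl (min_le_min le_rfl (hτ hab)))
          (fun j => ⟨(hσI i).1.trans (le_max_left _ _),
            max_le (hσI i).2 ((min_le_left _ _).trans (hσI (i + 1)).2)⟩) n
        have e0 : max (σ i) (min (σ (i + 1)) (τ 0)) = σ i := by
          rw [← h0]
          exact max_eq_left ((min_le_right _ _).trans (hσ (Nat.zero_le i)))
        have e1 : max (σ i) (min (σ (i + 1)) (τ n)) = σ (i + 1) := by
          rw [← h1, min_eq_left (hσ (by omega)), max_eq_right hle]
        simp only [e0, e1] at this
        refine this.trans ?_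
        rw [mul_assoc (sewC θ * K)]
        apply mul_le_mul_of_nonneg_left _ cK
        have hd : 0 ≤ σ (i + 1) - σ i := sub_nonneg.2 hle
        have : (σ (i + 1) - σ i) ^ θ = (σ (i + 1) - σ i) ^ (θ - 1) * (σ (i + 1) - σ i) := by
          nth_rewrite 3 [← Real.rpow_one (σ (i + 1) - σ i)]
          rw [← Real.rpow_add_of_nonneg hd (by linarith) (by norm_num)]
          simp
        rw [this]
        exact mul_le_mul_of_nonneg_right
          (Real.rpow_le_rpow hd (hμ i hi) (by linarith)) hd
    _ = sewC θ * K * μ ^ (θ - 1) * (σ m - σ 0) := by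
        rw [← Finset.mul_sum, Finset.sum_range_sub]
    _ ≤ _ := by
        have : σ m - σ 0 ≤ 1 := by linarith [(hσI m).2, (hσI 0).1]
        exact mul_le_of_le_one_right (by positivity) this

lemma compare (θ K : ℝ) (hθ : 1 < θ) (hK : 0 ≤ K) (A : ℝ → ℝ → ℝ)
    (hA0 : ∀ s, A s s = 0)
    (hA : ∀ s ∈ I01, ∀ u ∈ I01, ∀ t ∈ I01, s ≤ u → u ≤ t →
      |A s t - A s u - A u t| ≤ K * (t - s) ^ θ)
    (σ τ : ℕ → ℝ) (hσ : Monotone σ) (hτ : Monotone τ) (hσI : ∀ i, σ i ∈ I01)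
    (hτI : ∀ i, τ i ∈ I01) (m n : ℕ) (h0 : σ 0 = τ 0) (h1 : σ m = τ n)
    (μ ν : ℝ) (hμ0 : 0 ≤ μ) (hν0 : 0 ≤ ν) (hμ : ∀ i < m, σ (i + 1) - σ i ≤ μ)
    (hν : ∀ i < n, τ (i + 1) - τ i ≤ ν) :
    |∑ i ∈ Finset.range m, A (σ i) (σ (i + 1)) - ∑ i ∈ Finset.range n, A (τ i) (τ (i + 1))|
      ≤ sewC θ * K * (μ ^ (θ - 1) + ν ^ (θ - 1)) := by
  have a := half_compare θ K hθ hK A hA0 hA σ τ hσ hτ hσI hτI m n h0 h1 μ hμ0 hμ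
  have b := half_compare θ K hθ hK A hA0 hA τ σ hτ hσ hτI hσI n m h0.symm h1.symm ν hν0 hν
  rw [Finset.sum_comm] at b
  have e : ∑ i ∈ Finset.range m, ∑ j ∈ Finset.range n,
        A (max (σ i) (min (σ (i + 1)) (τ j))) (max (σ i) (min (σ (i + 1)) (τ (j + 1)))) =
      ∑ i ∈ Finset.range m, ∑ j ∈ Finset.range n,
        A (max (τ j) (min (τ (j + 1)) (σ i))) (max (τ j) (min (τ (j + 1)) (σ (i + 1)))) :=
    Finset.sum_congr rfl fun i _ => Finset.sum_congr rfl fun j _ =>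
      clamp_swap A hA0 _ _ _ _ (hσ (Nat.le_succ i)) (hτ (Nat.le_succ j))
  rw [e] at a
  rw [abs_le] at *
  constructor <;> linarith [a.1, a.2, b.1, b.2]

lemma rpow_mul_le (α s u t : ℝ) (hα : 0 ≤ α) (h1 : s ≤ u) (h2 : u ≤ t) :
    (u - s) ^ α * (t - u) ^ α ≤ (t - s) ^ (2 * α) := by
  rw [two_mul, Real.rpow_add_of_nonneg (by linarith) hα hα]
  have a := Real.rpow_le_rpow (sub_nonneg.2 h1) (by linarith : u - s ≤ t - s) hα
  have b := Real.rpow_le_rpow (sub_nonneg.2 h2) (by linarith : t - u ≤ t - s) hα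
  have : 0 ≤ (t - u) ^ α := Real.rpow_nonneg (by linarith) _
  have : 0 ≤ (t - s) ^ α := Real.rpow_nonneg (by linarith) _
  gcongr

lemma young1d (α : ℝ) (hα : 1 / 2 < α) (g h : ℝ → ℝ) (G H : ℝ) (hG : 0 ≤ G) (hH : 0 ≤ H)
    (g0 : ∀ t ∈ I01, |g t| ≤ G)
    (g1 : ∀ t ∈ I01, ∀ t' ∈ I01, |g t' - g t| ≤ G * |t' - t| ^ α)
    (h1 : ∀ t ∈ I01, ∀ t' ∈ I01, |h t' - h t| ≤ H * |t' - t| ^ α)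
    (τ : ℕ → ℝ) (hτ : Monotone τ) (hI : ∀ i, τ i ∈ I01) (n : ℕ) :
    |∑ j ∈ Finset.range n, g (τ j) * (h (τ (j + 1)) - h (τ j))| ≤
      (sewC (2 * α) + 1) * (G * H) := by
  have hθ : 1 < 2 * α := by linarith
  have key := sewing_range (2 * α) (G * H) hθ (mul_nonneg hG hH)
    (fun t t' => g t * (h t' - h t)) (by simp) (by
      intro s hs u hu t ht hsu hut
      have e : g s * (h t - h s) - g s * (h u - h s) - g u * (h t - h u) =
        -((g u - g s) * (h t - h u)) := by ring
      rw [e, abs_neg, abs_mul]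
      have a := g1 s hs u hu
      have b := h1 u hu t ht
      rw [abs_of_nonneg (sub_nonneg.2 hsu)] at a
      rw [abs_of_nonneg (sub_nonneg.2 hut)] at b
      calc _ ≤ (G * (u - s) ^ α) * (H * (t - u) ^ α) :=
            mul_le_mul a b (abs_nonneg _) ((abs_nonneg _).trans a)
        _ = G * H * ((u - s) ^ α * (t - u) ^ α) := by ring
        _ ≤ _ := mul_le_mul_of_nonneg_left (rpow_mul_le α s u t (by linarith) hsu hut)
            (mul_nonneg hG hH)) τ hτ hI n
  have d0 : 0 ≤ τ n - τ 0 := sub_nonneg.2 (hτ (Nat.zero_le n))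
  have d1 : τ n - τ 0 ≤ 1 := by linarith [(hI n).2, (hI 0).1]
  have b1 : |g (τ 0) * (h (τ n) - h (τ 0))| ≤ G * H := by
    rw [abs_mul]
    refine mul_le_mul (g0 _ (hI 0)) ((h1 _ (hI 0) _ (hI n)).trans ?_) (abs_nonneg _) hG
    exact mul_le_of_le_one_right hH (Real.rpow_le_one (abs_nonneg _)
      (by rwa [abs_of_nonneg d0]) (by linarith))
  have b2 : sewC (2 * α) * (G * H) * (τ n - τ 0) ^ (2 * α) ≤ sewC (2 * α) * (G * H) :=
    mul_le_of_le_one_right (mul_nonneg (sewC_nonneg hθ) (mul_nonneg hG hH))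
      (Real.rpow_le_one d0 d1 (by linarith))
  rw [abs_le] at *
  constructor <;> linarith [key.1, key.2, b1.1, b1.2]

/-- Real-number Hölder bounds. -/
structure HBd (a1 a2 : ℝ) (f : ℝ → ℝ → ℝ) (N : ℝ) : Prop where
  nonneg : 0 ≤ N
  rect : ∀ s ∈ I01, ∀ s' ∈ I01, ∀ t ∈ I01, ∀ t' ∈ I01,
    |dRect f s s' t t'| ≤ N * (|s' - s| ^ a1 * |t' - t| ^ a2)
  one : ∀ s ∈ I01, ∀ s' ∈ I01, ∀ t ∈ I01, |f s' t - f s t| ≤ N * |s' - s| ^ a1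
  two : ∀ s ∈ I01, ∀ t ∈ I01, ∀ t' ∈ I01, |f s t' - f s t| ≤ N * |t' - t| ^ a2

lemma HBd.swap {a1 a2 : ℝ} {f : ℝ → ℝ → ℝ} {N : ℝ} (h : HBd a1 a2 f N) :
    HBd a2 a1 (fun t s => f s t) N where
  nonneg := h.nonneg
  rect := by
    intro s hs s' hs' t ht t' ht'
    have := h.rect t ht t' ht' s hs s' hs'
    rw [mul_comm (|s' - s| ^ a2)]
    convert this using 2
    unfold dRect; ring
  one := fun s hs s' hs' t ht => h.two t ht s hs s' hs'
  two := fun s hs t ht t' ht' => h.one t ht t' ht' s hs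

lemma bound_of_ofReal {N : ℝ≥0∞} (hN : N ≠ ⊤) {a b : ℝ} (hb : 0 ≤ b) (hab : b = 0 → a = 0)
    (h : ENNReal.ofReal (|a| / b) ≤ N) : |a| ≤ N.toReal * b := by
  rcases hb.eq_or_lt with h0 | h0
  · rw [hab h0.symm, ← h0]; simp
  · rw [← div_le_iff₀ h0]
    exact (ENNReal.ofReal_le_iff_le_toReal hN).1 h

lemma abs_rpow_eq_zero_s18 {a b α : ℝ} (h : |a - b| ^ α = 0) : a = b := by
  rcases (Real.rpow_eq_zero_iff_of_nonneg (abs_nonneg _)).1 h with ⟨h, _⟩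
  exact sub_eq_zero.1 (abs_eq_zero.1 h)

lemma HBd_of_NN (a1 a2 : ℝ) (f : ℝ → ℝ → ℝ) (h : NN a1 a2 f ≠ ⊤) :
    HBd a1 a2 f (NN a1 a2 f).toReal where
  nonneg := ENNReal.toReal_nonneg
  rect := by
    intro s hs s' hs' t ht t' ht'
    refine bound_of_ofReal h (by positivity) ?_ ?_
    · intro h0
      rcases mul_eq_zero.1 h0 with h0 | h0
      · rw [abs_rpow_eq_zero_s18 h0]; unfold dRect; ring
      · rw [abs_rpow_eq_zero_s18 h0]; unfold dRect; ring
    · have h1 : ENNReal.ofReal (|dRect f s s' t t'| / (|s' - s| ^ a1 * |t' - t| ^ a2))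
          ≤ holRect a1 a2 f :=
        le_iSup_of_le ⟨s, hs⟩ (le_iSup_of_le ⟨s', hs'⟩ (le_iSup_of_le ⟨t, ht⟩
          (le_iSup_of_le ⟨t', ht'⟩ le_rfl)))
      exact h1.trans (le_self_add.trans (le_self_add.trans le_self_add))
  one := by
    intro s hs s' hs' t ht
    refine bound_of_ofReal h (by positivity) ?_ ?_
    · intro h0
      rw [abs_rpow_eq_zero_s18 h0]; ring
    · have h1 : ENNReal.ofReal (|f s' t - f s t| / |s' - s| ^ a1) ≤ hol1 a1 f :=
        le_iSup_of_le ⟨s, hs⟩ (le_iSup_of_le ⟨s', hs'⟩ (le_iSup_of_le ⟨t, ht⟩ le_rfl))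
      exact h1.trans (le_add_self.trans (le_self_add.trans le_self_add))
  two := by
    intro s hs t ht t' ht'
    refine bound_of_ofReal h (by positivity) ?_ ?_
    · intro h0
      rw [abs_rpow_eq_zero_s18 h0]; ring
    · have h1 : ENNReal.ofReal (|f s t' - f s t| / |t' - t| ^ a2) ≤ hol2 a2 f :=
        le_iSup_of_le ⟨s, hs⟩ (le_iSup_of_le ⟨t, ht⟩ (le_iSup_of_le ⟨t', ht'⟩ le_rfl))
      exact h1.trans (le_add_self.trans le_self_add)

/-- Riemann sums. -/
def RS (x y : ℝ → ℝ → ℝ) (m n : ℕ) (σ τ : ℕ → ℝ) : ℝ :=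
  ∑ i ∈ Finset.range m, ∑ j ∈ Finset.range n,
    y (σ i) (τ j) * dRect x (σ i) (σ (i + 1)) (τ j) (τ (j + 1))

lemma RS_swap (x y : ℝ → ℝ → ℝ) (m n : ℕ) (σ τ : ℕ → ℝ) :
    RS x y m n σ τ = RS (fun t s => x s t) (fun t s => y s t) n m τ σ := by
  unfold RS
  rw [Finset.sum_comm]
  refine Finset.sum_congr rfl fun i _ => Finset.sum_congr rfl fun j _ => ?_
  unfold dRect; ring

/-- (Weak) partition of `[a,b]` with mesh at most `μ`. -/
structure WPart (a b : ℝ) (m : ℕ) (σ : ℕ → ℝ) (μ : ℝ) : Prop where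
  mono : Monotone σ
  mem : ∀ i, σ i ∈ I01
  start : σ 0 = a
  fin' : σ m = b
  mesh0 : 0 ≤ μ
  mesh : ∀ i < m, σ (i + 1) - σ i ≤ μ

lemma RS_first (α1 α2 : ℝ) (hα1 : 1 / 2 < α1) (hα2 : 1 / 2 < α2) (x y : ℝ → ℝ → ℝ)
    (X Y : ℝ) (hx : HBd α1 α2 x X) (hy : HBd α1 α2 y Y) (a b c d : ℝ) (m m' n : ℕ)
    (σ σ' τ : ℕ → ℝ) (μ μ' ν : ℝ) (hσ : WPart a b m σ μ) (hσ' : WPart a b m' σ' μ')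
    (hτ : WPart c d n τ ν) :
    |RS x y m n σ τ - RS x y m' n σ' τ| ≤
      sewC (2 * α1) * ((sewC (2 * α2) + 1) * (Y * X)) *
        (μ ^ (2 * α1 - 1) + μ' ^ (2 * α1 - 1)) := by
  have hc2 : 0 ≤ sewC (2 * α2) := sewC_nonneg (by linarith)
  have hX := hx.nonneg
  have hY := hy.nonneg
  refine compare (2 * α1) ((sewC (2 * α2) + 1) * (Y * X)) (by linarith) (by positivity)
    (fun s s' => ∑ j ∈ Finset.range n, y s (τ j) * dRect x s s' (τ j) (τ (j + 1)))
    ?_ ?_ σ σ' hσ.mono hσ'.mono hσ.mem hσ'.mem m m' (hσ.start.trans hσ'.start.symm)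
    (hσ.fin'.trans hσ'.fin'.symm) μ μ' hσ.mesh0 hσ'.mesh0 hσ.mesh hσ'.mesh
  · intro s
    refine Finset.sum_eq_zero fun j _ => ?_
    unfold dRect; ring
  · intro s hs u hu t ht hsu hut
    have e : (∑ j ∈ Finset.range n, y s (τ j) * dRect x s t (τ j) (τ (j + 1))) -
        (∑ j ∈ Finset.range n, y s (τ j) * dRect x s u (τ j) (τ (j + 1))) -
        (∑ j ∈ Finset.range n, y u (τ j) * dRect x u t (τ j) (τ (j + 1))) =
        -∑ j ∈ Finset.range n, (fun r => y u r - y s r) (τ j) *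
          ((fun r => x t r - x u r) (τ (j + 1)) - (fun r => x t r - x u r) (τ j)) := by
      rw [← Finset.sum_sub_distrib, ← Finset.sum_sub_distrib, ← Finset.sum_neg_distrib]
      refine Finset.sum_congr rfl fun j _ => ?_
      unfold dRect; ring
    simp only [] at e ⊢
    rw [e, abs_neg]
    have p1 : 0 ≤ (u - s) ^ α1 := Real.rpow_nonneg (by linarith) _
    have p2 : 0 ≤ (t - u) ^ α1 := Real.rpow_nonneg (by linarith) _
    refine (young1d α2 hα2 (fun r => y u r - y s r) (fun r => x t r - x u r)
      (Y * (u - s) ^ α1) (X * (t - u) ^ α1) (by positivity) (by positivity)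
      ?_ ?_ ?_ τ hτ.mono hτ.mem n).trans ?_
    · intro r hr
      have := hy.one s hs u hu r hr
      rwa [abs_of_nonneg (sub_nonneg.2 hsu)] at this
    · intro r hr r' hr'
      have := hy.rect s hs u hu r hr r' hr'
      rw [abs_of_nonneg (sub_nonneg.2 hsu), ← mul_assoc] at this
      convert this using 2
      unfold dRect; ring
    · intro r hr r' hr'
      have := hx.rect u hu t ht r hr r' hr'
      rw [abs_of_nonneg (sub_nonneg.2 hut), ← mul_assoc] at this
      convert this using 2
      unfold dRect; ring
    · have := rpow_mul_le α1 s u t (by linarith) hsu hut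
      calc _ = (sewC (2 * α2) + 1) * (Y * X) * ((u - s) ^ α1 * (t - u) ^ α1) := by ring
        _ ≤ _ := mul_le_mul_of_nonneg_left this (by positivity)

/-- The final constant. -/
def finC (α1 α2 : ℝ) : ℝ :=
  sewC (2 * α1) * (sewC (2 * α2) + 1) + sewC (2 * α2) * (sewC (2 * α1) + 1)

lemma RS_both (α1 α2 : ℝ) (hα1 : 1 / 2 < α1) (hα2 : 1 / 2 < α2) (x y : ℝ → ℝ → ℝ)
    (X Y : ℝ) (hx : HBd α1 α2 x X) (hy : HBd α1 α2 y Y) (a b c d : ℝ) (m m' n n' : ℕ)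
    (σ σ' τ τ' : ℕ → ℝ) (μ μ' ν ν' : ℝ) (hσ : WPart a b m σ μ) (hσ' : WPart a b m' σ' μ')
    (hτ : WPart c d n τ ν) (hτ' : WPart c d n' τ' ν') :
    |RS x y m n σ τ - RS x y m' n' σ' τ'| ≤
      finC α1 α2 * Y * X * ((μ ^ (2 * α1 - 1) + ν ^ (2 * α2 - 1)) +
        (μ' ^ (2 * α1 - 1) + ν' ^ (2 * α2 - 1))) := by
  have h1 := RS_first α1 α2 hα1 hα2 x y X Y hx hy a b c d m m' n σ σ' τ μ μ' ν hσ hσ' hτ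
  have h2 := RS_first α2 α1 hα2 hα1 _ _ X Y hx.swap hy.swap c d a b n n' m' τ τ' σ' ν ν' μ'
    hτ hτ' hσ'
  rw [← RS_swap x y, ← RS_swap x y] at h2
  refine (abs_sub_le _ (RS x y m' n σ' τ) _).trans ((add_le_add h1 h2).trans ?_)
  have hc1 : 0 ≤ sewC (2 * α1) := sewC_nonneg (by linarith)
  have hc2 : 0 ≤ sewC (2 * α2) := sewC_nonneg (by linarith)
  have hX := hx.nonneg
  have hY := hy.nonneg
  have q1 := Real.rpow_nonneg hσ.mesh0 (2 * α1 - 1)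
  have q2 := Real.rpow_nonneg hσ'.mesh0 (2 * α1 - 1)
  have q3 := Real.rpow_nonneg hτ.mesh0 (2 * α2 - 1)
  have q4 := Real.rpow_nonneg hτ'.mesh0 (2 * α2 - 1)
  unfold finC
  have e1 : 0 ≤ sewC (2 * α1) * ((sewC (2 * α2) + 1) * (Y * X)) *
      (ν ^ (2 * α2 - 1) + ν' ^ (2 * α2 - 1)) := by positivity
  have e2 : 0 ≤ sewC (2 * α2) * ((sewC (2 * α1) + 1) * (Y * X)) *
      (μ ^ (2 * α1 - 1) + μ' ^ (2 * α1 - 1)) := by positivity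
  linarith

/-- Uniform partition. -/
def unif (a b : ℝ) (n : ℕ) (i : ℕ) : ℝ := a + (b - a) * ((min i (n + 1) : ℕ) / ((n : ℝ) + 1))

lemma unif_part (a b : ℝ) (ha : a ∈ I01) (hb : b ∈ I01) (hab : a ≤ b) (n : ℕ) :
    WPart a b (n + 1) (unif a b n) (1 / ((n : ℝ) + 1)) := by
  have hn : (0 : ℝ) < (n : ℝ) + 1 := by positivity
  have hd : 0 ≤ b - a := sub_nonneg.2 hab
  have hd1 : b - a ≤ 1 := by linarith [hb.2, ha.1]
  refine ⟨?_, ?_, ?_, ?_, by positivity, ?_⟩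
  · intro i j hij
    have : ((min i (n + 1) : ℕ) : ℝ) ≤ ((min j (n + 1) : ℕ) : ℝ) := by
      exact_mod_cast min_le_min_right _ hij
    unfold unif
    gcongr
  · intro i
    have h0 : (0 : ℝ) ≤ (min i (n + 1) : ℕ) / ((n : ℝ) + 1) := by positivity
    have h1 : ((min i (n + 1) : ℕ) : ℝ) / ((n : ℝ) + 1) ≤ 1 := by
      rw [div_le_one hn]
      exact_mod_cast min_le_right _ _
    unfold unif
    constructor
    · have := mul_nonneg hd h0; linarith [ha.1]
    · have := mul_le_of_le_one_right hd h1; linarith [hb.2]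
  · simp [unif]
  · unfold unif
    rw [min_self]; push_cast
    rw [div_self hn.ne']; ring
  · intro i hi
    unfold unif
    rw [min_eq_left (by omega), min_eq_left (by omega)]
    push_cast
    have : a + (b - a) * (((i : ℝ) + 1) / ((n : ℝ) + 1)) - (a + (b - a) * ((i : ℝ) / ((n : ℝ) + 1)))
        = (b - a) * (1 / ((n : ℝ) + 1)) := by ring
    rw [this]
    exact mul_le_of_le_one_left (by positivity) hd1

lemma part_of_strict (a b : ℝ) (ha : a ∈ I01) (hb : b ∈ I01) (m : ℕ) (σ : ℕ → ℝ) (μ : ℝ)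
    (h0 : σ 0 = a) (h1 : σ m = b) (hs : ∀ i < m, σ i < σ (i + 1)) (hμ : 0 ≤ μ)
    (hm : ∀ i < m, σ (i + 1) - σ i ≤ μ) : WPart a b m (fun i => σ (min i m)) μ := by
  have mono : Monotone (fun i => σ (min i m)) := by
    refine monotone_nat_of_le_succ fun i => ?_
    rcases lt_or_ge i m with h | h
    · simp only [min_eq_left h.le, min_eq_left (Nat.succ_le_of_lt h)]
      exact (hs i h).le
    · simp only [min_eq_right h, min_eq_right (h.trans (Nat.le_succ i)), le_refl]
  refine ⟨mono, fun i => ⟨?_, ?_⟩, by simpa using h0, by simpa using h1, hμ, fun i hi => ?_⟩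
  · have := mono (Nat.zero_le i)
    simp only [Nat.zero_min, h0] at this
    exact ha.1.trans this
  · have := mono (le_max_left i m)
    simp only [min_eq_right (le_max_right i m), h1] at this
    exact this.trans hb.2
  · simp only [min_eq_left hi.le, min_eq_left (Nat.succ_le_of_lt hi)]
    exact hm i hi

lemma RS_min (x y : ℝ → ℝ → ℝ) (m n : ℕ) (σ τ : ℕ → ℝ) :
    RS x y m n (fun i => σ (min i m)) (fun j => τ (min j n)) = RS x y m n σ τ := by
  unfold RS
  refine Finset.sum_congr rfl fun i hi => Finset.sum_congr rfl fun j hj => ?_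
  rw [Finset.mem_range] at hi hj
  simp only [min_eq_left hi.le, min_eq_left (Nat.succ_le_of_lt hi), min_eq_left hj.le,
    min_eq_left (Nat.succ_le_of_lt hj)]

lemma tendsto_rate (α1 α2 : ℝ) (hα1 : 1 / 2 < α1) (hα2 : 1 / 2 < α2) (c : ℝ) :
    Tendsto (fun n : ℕ => c * ((1 / ((n : ℝ) + 1)) ^ (2 * α1 - 1) +
      (1 / ((n : ℝ) + 1)) ^ (2 * α2 - 1))) atTop (𝓝 0) := by
  have h := tendsto_one_div_add_atTop_nhds_zero_nat (𝕜 := ℝ)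
  have h1 := h.rpow_const (p := 2 * α1 - 1) (Or.inr (by linarith))
  have h2 := h.rpow_const (p := 2 * α2 - 1) (Or.inr (by linarith))
  rw [Real.zero_rpow (by linarith)] at h1 h2
  simpa using (h1.add h2).const_mul c

lemma exists_limit (α1 α2 : ℝ) (hα1 : 1 / 2 < α1) (hα2 : 1 / 2 < α2) (x y : ℝ → ℝ → ℝ)
    (X Y : ℝ) (hx : HBd α1 α2 x X) (hy : HBd α1 α2 y Y) (a b c d : ℝ)
    (ha : a ∈ I01) (hb : b ∈ I01) (hc : c ∈ I01) (hd : d ∈ I01) (hab : a ≤ b) (hcd : c ≤ d) :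
    ∃ z : ℝ, ∀ (m n : ℕ) (σ τ : ℕ → ℝ) (μ ν : ℝ), WPart a b m σ μ → WPart c d n τ ν →
      |z - RS x y m n σ τ| ≤
        finC α1 α2 * Y * X * (μ ^ (2 * α1 - 1) + ν ^ (2 * α2 - 1)) := by
  set u : ℕ → ℝ := fun n => RS x y (n + 1) (n + 1) (unif a b n) (unif c d n) with hu
  set r : ℕ → ℝ := fun n => (1 / ((n : ℝ) + 1)) ^ (2 * α1 - 1) +
      (1 / ((n : ℝ) + 1)) ^ (2 * α2 - 1) with hr
  have hr0 : Tendsto (fun n => finC α1 α2 * Y * X * r n) atTop (𝓝 0) :=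
    tendsto_rate α1 α2 hα1 hα2 _
  have hdist : ∀ n k, |u n - u k| ≤ finC α1 α2 * Y * X * (r n + r k) := fun n k =>
    RS_both α1 α2 hα1 hα2 x y X Y hx hy a b c d _ _ _ _ _ _ _ _ _ _ _ _
      (unif_part a b ha hb hab n) (unif_part a b ha hb hab k)
      (unif_part c d hc hd hcd n) (unif_part c d hc hd hcd k)
  have hcau : CauchySeq u := by
    rw [Metric.cauchySeq_iff]
    intro ε hε
    have := hr0.eventually (gt_mem_nhds (half_pos hε))
    obtain ⟨N, hN⟩ := eventually_atTop.1 this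
    refine ⟨N, fun n hn k hk => ?_⟩
    rw [Real.dist_eq]
    have := hdist n k
    rw [mul_add] at this
    linarith [hN n hn, hN k hk]
  obtain ⟨z, hz⟩ := cauchySeq_tendsto_of_complete hcau
  refine ⟨z, fun m n σ τ μ ν hσ hτ => ?_⟩
  have l1 : Tendsto (fun k => |u k - RS x y m n σ τ|) atTop (𝓝 |z - RS x y m n σ τ|) :=
    (hz.sub_const _).abs
  have l2 : Tendsto (fun k => finC α1 α2 * Y * X * r k +
      finC α1 α2 * Y * X * (μ ^ (2 * α1 - 1) + ν ^ (2 * α2 - 1))) atTop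
      (𝓝 (0 + finC α1 α2 * Y * X * (μ ^ (2 * α1 - 1) + ν ^ (2 * α2 - 1)))) :=
    hr0.add_const _
  rw [zero_add] at l2
  refine le_of_tendsto_of_tendsto' l1 l2 fun k => ?_
  rw [← mul_add]
  exact RS_both α1 α2 hα1 hα2 x y X Y hx hy a b c d _ _ _ _ _ _ _ _ _ _ _ _
      (unif_part a b ha hb hab k) hσ (unif_part c d hc hd hcd k) hτ

lemma exists_limit' (α1 α2 : ℝ) (hα1 : 1 / 2 < α1) (hα2 : 1 / 2 < α2) (x y : ℝ → ℝ → ℝ)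
    (X Y : ℝ) (hx : HBd α1 α2 x X) (hy : HBd α1 α2 y Y) :
    ∃ z : ℝ → ℝ → ℝ → ℝ → ℝ, ∀ a ∈ I01, ∀ b ∈ I01, ∀ c ∈ I01, ∀ d ∈ I01, a ≤ b → c ≤ d →
      ∀ (m n : ℕ) (σ τ : ℕ → ℝ) (μ ν : ℝ), WPart a b m σ μ → WPart c d n τ ν →
      |z a b c d - RS x y m n σ τ| ≤
        finC α1 α2 * Y * X * (μ ^ (2 * α1 - 1) + ν ^ (2 * α2 - 1)) := by
  classical
  have key := fun a b c d => exists_limit α1 α2 hα1 hα2 x y X Y hx hy a b c d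
  choose z hz using key
  refine ⟨fun a b c d => if h : (a ∈ I01 ∧ b ∈ I01) ∧ (c ∈ I01 ∧ d ∈ I01) ∧ a ≤ b ∧ c ≤ d then
    z a b c d h.1.1 h.1.2 h.2.1.1 h.2.1.2 h.2.2.1 h.2.2.2 else 0, ?_⟩
  intro a ha b hb c hc d hd hab hcd
  have h : (a ∈ I01 ∧ b ∈ I01) ∧ (c ∈ I01 ∧ d ∈ I01) ∧ a ≤ b ∧ c ≤ d :=
    ⟨⟨ha, hb⟩, ⟨hc, hd⟩, hab, hcd⟩
  simp only [dif_pos h]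
  exact hz a b c d ha hb hc hd hab hcd

theorem rate_of_convergence_2d_young_riemann_sums
    (α1 α2 : ℝ) (hα1 : 1 / 2 < α1) (hα2 : 1 / 2 < α2) :
    ∃ C : ℝ, 0 ≤ C ∧ ∀ x y : ℝ → ℝ → ℝ,
      ContinuousOn (fun p : ℝ × ℝ => x p.1 p.2) (I01 ×ˢ I01) →
      ContinuousOn (fun p : ℝ × ℝ => y p.1 p.2) (I01 ×ˢ I01) →
      NN α1 α2 x ≠ ⊤ → NN α1 α2 y ≠ ⊤ →
      ∃ z : ℝ → ℝ → ℝ → ℝ → ℝ,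
        ∀ s1 ∈ I01, ∀ s2 ∈ I01, ∀ t1 ∈ I01, ∀ t2 ∈ I01, s1 ≤ s2 → t1 ≤ t2 →
          (∀ (m m' : ℕ → ℕ) (σ τ : ℕ → ℕ → ℝ),
            IsPartSeq s1 s2 m σ → IsPartSeq t1 t2 m' τ →
            Tendsto (fun n => ∑ i ∈ Finset.range (m n), ∑ j ∈ Finset.range (m' n),
                y (σ n i) (τ n j) * dRect x (σ n i) (σ n (i + 1)) (τ n j) (τ n (j + 1)))
              atTop (𝓝 (z s1 s2 t1 t2))) ∧
          (∀ (m m' : ℕ) (σ τ : ℕ → ℝ) (μ1 μ2 : ℝ),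
            σ 0 = s1 → σ m = s2 → (∀ i < m, σ i < σ (i + 1)) →
            τ 0 = t1 → τ m' = t2 → (∀ j < m', τ j < τ (j + 1)) →
            0 ≤ μ1 → 0 ≤ μ2 →
            (∀ i < m, σ (i + 1) - σ i ≤ μ1) → (∀ j < m', τ (j + 1) - τ j ≤ μ2) →
            |z s1 s2 t1 t2 -
                ∑ i ∈ Finset.range m, ∑ j ∈ Finset.range m',
                  y (σ i) (τ j) * dRect x (σ i) (σ (i + 1)) (τ j) (τ (j + 1))| ≤
              C * (NN α1 α2 y).toReal * (NN α1 α2 x).toReal *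
                (μ1 ^ (2 * α1 - 1) + μ2 ^ (2 * α2 - 1))) := by
  refine ⟨finC α1 α2, ?_, ?_⟩
  · have hc1 : 0 ≤ sewC (2 * α1) := sewC_nonneg (by linarith)
    have hc2 : 0 ≤ sewC (2 * α2) := sewC_nonneg (by linarith)
    unfold finC; positivity
  intro x y _ _ hx hy
  obtain ⟨z, hz⟩ := exists_limit' α1 α2 hα1 hα2 x y _ _ (HBd_of_NN α1 α2 x hx)
    (HBd_of_NN α1 α2 y hy)
  refine ⟨z, fun s1 hs1 s2 hs2 t1 ht1 t2 ht2 hs ht => ?_⟩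
  have hrate : ∀ (m m' : ℕ) (σ τ : ℕ → ℝ) (μ1 μ2 : ℝ),
      σ 0 = s1 → σ m = s2 → (∀ i < m, σ i < σ (i + 1)) →
      τ 0 = t1 → τ m' = t2 → (∀ j < m', τ j < τ (j + 1)) →
      0 ≤ μ1 → 0 ≤ μ2 →
      (∀ i < m, σ (i + 1) - σ i ≤ μ1) → (∀ j < m', τ (j + 1) - τ j ≤ μ2) →
      |z s1 s2 t1 t2 - RS x y m m' σ τ| ≤
        finC α1 α2 * (NN α1 α2 y).toReal * (NN α1 α2 x).toReal *
          (μ1 ^ (2 * α1 - 1) + μ2 ^ (2 * α2 - 1)) := by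
    intro m m' σ τ μ1 μ2 a1 a2 a3 b1 b2 b3 c1 c2 d1 d2
    rw [← RS_min]
    exact hz s1 hs1 s2 hs2 t1 ht1 t2 ht2 hs ht m m' _ _ μ1 μ2
      (part_of_strict s1 s2 hs1 hs2 m σ μ1 a1 a2 a3 c1 d1)
      (part_of_strict t1 t2 ht1 ht2 m' τ μ2 b1 b2 b3 c2 d2)
  refine ⟨?_, hrate⟩
  intro m m' σ τ hσ hτ
  obtain ⟨p0, p1, p2, p3⟩ := hσ
  obtain ⟨q0, q1, q2, q3⟩ := hτ
  rw [Metric.tendsto_atTop]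
  intro ε hε
  have hr := (tendsto_rate α1 α2 hα1 hα2
    (finC α1 α2 * (NN α1 α2 y).toReal * (NN α1 α2 x).toReal)).eventually (gt_mem_nhds hε)
  obtain ⟨k, hk⟩ := hr.exists
  have hpos : (0 : ℝ) < 1 / ((k : ℝ) + 1) := by positivity
  obtain ⟨N1, hN1⟩ := p3 _ hpos
  obtain ⟨N2, hN2⟩ := q3 _ hpos
  refine ⟨max N1 N2, fun n hn => ?_⟩
  rw [dist_comm, Real.dist_eq]
  refine lt_of_le_of_lt (hrate (m n) (m' n) (σ n) (τ n) _ _ (p0 n) (p1 n) (p2 n) (q0 n) (q1 n)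
    (q2 n) hpos.le hpos.le
    (fun i hi => (hN1 n ((le_max_left _ _).trans hn) i hi).le)
    (fun i hi => (hN2 n ((le_max_right _ _).trans hn) i hi).le)) hk
end
end
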